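/- arXiv:math/0310029 — 2 statements merged into one kernel-verified Lean document; each statement's English description precedes it below -/
import Mathlib

section
/- For m, n even with m ≥ n, the mod-2 reductions g = Pf/2^{μ−ν} mod 2 and h = (Σ_π sgn(π)·D^{(π(1),…,π(n))}·Pf^{(π(n+1),…,π(m))})/2^{μ−ν} mod 2 coincide: both equal the sum of all m-linear monomials in which each pair of letters x_r, y_r occurs a strictly positive even number of times in alternating order. -/
open MvPolynomial

/-- Permutations giving a canonical perfect matching: σ(2i) < σ(2i+1) and σ(2i) increasing. -/
def pfPerms (μ : ℕ) : Finset (Equiv.Perm (Fin (2*μ))) :=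
  Finset.univ.filter fun σ =>
    (∀ i : Fin μ, σ ⟨2*i.1, by have := i.2; omega⟩ < σ ⟨2*i.1+1, by have := i.2; omega⟩) ∧
    (∀ i j : Fin μ, i < j →
      σ ⟨2*i.1, by have := i.2; omega⟩ < σ ⟨2*j.1, by have := j.2; omega⟩)


/-- The Pfaffian of a `2μ × 2μ` matrix (intended for skew-symmetric matrices). -/
def pfaffian {R : Type*} [CommRing R] {μ : ℕ} (A : Matrix (Fin (2*μ)) (Fin (2*μ)) R) : R :=
  ∑ σ ∈ pfPerms μ, (Equiv.Perm.sign σ : ℤ) •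
    ∏ i : Fin μ, A (σ ⟨2*i.1, by have := i.2; omega⟩) (σ ⟨2*i.1+1, by have := i.2; omega⟩)


/-- The exponent vector of the `m`-linear monomial in which vector `i` contributes
its coordinate `c i`. -/
noncomputable def expOf {m n : ℕ} (c : Fin m → Fin n) : (Fin m × Fin n) →₀ ℕ :=
  ∑ i : Fin m, Finsupp.single (i, c i) 1


/-- The number `m_r` of occurrences of letters from group `r` (the pair `x_r, y_r`,
coordinates `2r, 2r+1`; for `n` odd, group `n/2` is the letter `z`). -/
def cnt {m n : ℕ} (c : Fin m → Fin n) (r : ℕ) : ℕ :=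
  (Finset.univ.filter fun i : Fin m => (c i).1 / 2 = r).card


/-- In the monomial encoded by `c`, the letters `x_r` (coordinate `2r`) and `y_r`
(coordinate `2r+1`) occur in alternating order. -/
def Alt {m n : ℕ} (c : Fin m → Fin n) (r : ℕ) : Prop :=
  ∀ i j : Fin m, i < j → (c i).1 / 2 = r → (c j).1 / 2 = r →
    (∀ l : Fin m, i < l → l < j → (c l).1 / 2 ≠ r) → c i ≠ c j


/-- The polarized scalar product `B⁽ⁱʲ⁾` of the generic vectors `v⁽ⁱ⁾` and `v⁽ʲ⁾`. -/
noncomputable def Bpoly (n m : ℕ) (i j : Fin m) : MvPolynomial (Fin m × Fin n) ℤ :=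
  (∑ r : Fin (n/2),
      (X (i, ⟨2*r.1, by have := r.2; omega⟩) * X (j, ⟨2*r.1+1, by have := r.2; omega⟩)
       + X (i, ⟨2*r.1+1, by have := r.2; omega⟩) * X (j, ⟨2*r.1, by have := r.2; omega⟩)))
  + if h : n % 2 = 1 then 2 * X (i, ⟨n-1, by omega⟩) * X (j, ⟨n-1, by omega⟩) else 0


/-- The `2μ × 2μ` skew-symmetric matrix of the `B⁽ⁱʲ⁾`. -/
noncomputable def Bmat (n μ : ℕ) :
    Matrix (Fin (2*μ)) (Fin (2*μ)) (MvPolynomial (Fin (2*μ) × Fin n) ℤ) :=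
  fun i j => if i < j then Bpoly n (2*μ) i j else if j < i then -(Bpoly n (2*μ) j i) else 0


/-- The determinant `D^{(w(1),…,w(n))}` of the matrix whose columns are the generic vectors
`v^{(w 1)}, …, v^{(w n)}`. -/
noncomputable def Dpoly (n m : ℕ) (w : Fin n → Fin m) : MvPolynomial (Fin m × Fin n) ℤ :=
  Matrix.det (Matrix.of fun a b : Fin n => (X (w b, a) : MvPolynomial (Fin m × Fin n) ℤ))


/-- The alternating sum `Σ_π sgn(π) · D^{(π(1),…,π(n))} · Pf^{(π(n+1),…,π(m))}` over permutations
`π` of `{1,…,m}` increasing on the first `n` and on the last `m−n` positions. -/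
noncomputable def DPfSum (n m : ℕ) (hnm : n ≤ m) : MvPolynomial (Fin m × Fin n) ℤ :=
  ∑ σ ∈ (Finset.univ.filter fun σ : Equiv.Perm (Fin m) =>
      (∀ i j : Fin m, i < j → j.1 < n → σ i < σ j) ∧
      (∀ i j : Fin m, i < j → n ≤ i.1 → σ i < σ j)),
    (Equiv.Perm.sign σ : ℤ) •
      (Dpoly n m (fun a => σ ⟨a.1, by have := a.2; omega⟩) *
       pfaffian (μ := (m - n)/2) (fun a b =>
         if a < b then
           Bpoly n m (σ ⟨n + a.1, by have := a.2; omega⟩) (σ ⟨n + b.1, by have := b.2; omega⟩)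
         else if b < a then
           -(Bpoly n m (σ ⟨n + b.1, by have := b.2; omega⟩) (σ ⟨n + a.1, by have := a.2; omega⟩))
         else 0))


set_option linter.unusedSectionVars false

section Part1

variable {ι κ M : Type*} [Fintype ι] [DecidableEq ι] [Fintype κ] [DecidableEq κ]
  [Fintype M] [DecidableEq M]

def hTerm (e : ι ⊕ κ × Bool ≃ M) (V : ι → M → ℤ) (B : M → M → ℤ) (f : M → M) : ℤ :=
  (∏ b, V b (f (e (Sum.inl b)))) *
    ∏ a, B (f (e (Sum.inr (a, false)))) (f (e (Sum.inr (a, true))))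

def sTerm (e : ι ⊕ κ × Bool ≃ M) (V : ι → M → ℤ) (B : M → M → ℤ) (t : Equiv.Perm M) : ℤ :=
  (Equiv.Perm.sign t : ℤ) * hTerm e V B t

lemma tensor_congr (P : Matrix M M ℤ) (Φ : (M → M) → ℤ) :
    ∑ τ : Equiv.Perm M, (Equiv.Perm.sign τ : ℤ) * ∑ g : M → M, Φ g * ∏ p, P (τ p) (g p) =
      P.det * ∑ τ : Equiv.Perm M, (Equiv.Perm.sign τ : ℤ) * Φ τ := by
  have h1 : ∀ g : M → M, ∑ τ : Equiv.Perm M, (Equiv.Perm.sign τ : ℤ) * ∏ p, P (τ p) (g p) =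
      (P.submatrix id g).det := by
    intro g
    rw [Matrix.det_apply']
    rfl
  have h2 : ∑ τ : Equiv.Perm M, (Equiv.Perm.sign τ : ℤ) * ∑ g : M → M, Φ g * ∏ p, P (τ p) (g p) =
      ∑ g : M → M, Φ g * (P.submatrix id g).det := by
    simp_rw [Finset.mul_sum]
    rw [Finset.sum_comm]
    refine Finset.sum_congr rfl fun g _ => ?_
    rw [← h1, Finset.mul_sum]
    refine Finset.sum_congr rfl fun τ _ => by ring
  rw [h2, Finset.mul_sum]
  symm
  refine Finset.sum_of_injOn (fun τ : Equiv.Perm M => (τ : M → M)) ?_ (by simp) ?_ ?_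
  · intro a _ b _ h
    exact DFunLike.coe_injective h
  · intro g _ hg
    have : ¬ Function.Injective g := by
      intro hi
      apply hg
      refine ⟨Equiv.ofBijective g (Finite.injective_iff_bijective.1 hi), by simp, rfl⟩
    simp only [Function.Injective, not_forall] at this
    obtain ⟨i, j, hij, hne⟩ := this
    rw [Matrix.det_zero_of_column_eq hne (by intro k; simp [hij]), mul_zero]
  · intro τ _
    rw [Matrix.det_permute']
    simp only [Int.cast_id]
    ring

def cV (P : Matrix M M ℤ) (V : ι → M → ℤ) : ι → M → ℤ := fun b i => ∑ j, P i j * V b j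

def cB (P : Matrix M M ℤ) (B : M → M → ℤ) : M → M → ℤ :=
  fun i j => ∑ k, P i k * ∑ l, P j l * B k l

lemma hTerm_congr (e : ι ⊕ κ × Bool ≃ M) (V : ι → M → ℤ) (B : M → M → ℤ) (P : Matrix M M ℤ)
    (f : M → M) :
    hTerm e (cV P V) (cB P B) f = ∑ g : M → M, hTerm e V B g * ∏ p, P (f p) (g p) := by
  have e1 : (M → M) ≃ (ι → M) × (κ → M × M) :=
    Equiv.refl _ |>.trans <| (Equiv.arrowCongr e.symm (Equiv.refl M)).trans <|
      (Equiv.sumArrowEquivProdArrow _ _ _).trans <|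
      Equiv.prodCongr (Equiv.refl _) <|
        (Equiv.curry _ _ _).trans (Equiv.arrowCongr (Equiv.refl κ) (Equiv.boolArrowEquivProd M))
  let e2 : (ι → M) × (κ → M × M) ≃ (M → M) :=
    { toFun := fun q p => Sum.elim q.1 (fun z => if z.2 then (q.2 z.1).2 else (q.2 z.1).1) (e.symm p)
      invFun := fun g => (fun b => g (e (Sum.inl b)),
        fun a => (g (e (Sum.inr (a, false))), g (e (Sum.inr (a, true)))))
      left_inv := by
        rintro ⟨u, v⟩
        simp
      right_inv := by
        intro g
        funext p
        obtain ⟨z, rfl⟩ := e.surjective p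
        rcases z with b | ⟨a, (_ | _)⟩ <;> simp }
  rw [← Equiv.sum_comp e2]
  rw [Fintype.sum_prod_type]
  unfold hTerm cV cB
  have hB : ∀ i j, ∑ k, P i k * ∑ l, P j l * B k l =
      ∑ q : M × M, P i q.1 * P j q.2 * B q.1 q.2 := by
    intro i j
    rw [Fintype.sum_prod_type]
    refine Finset.sum_congr rfl fun k _ => ?_
    rw [Finset.mul_sum]
    exact Finset.sum_congr rfl fun l _ => by ring
  simp_rw [hB]
  rw [Fintype.prod_sum, Fintype.prod_sum, Finset.sum_mul_sum]
  refine Finset.sum_congr rfl fun u _ => Finset.sum_congr rfl fun v _ => ?_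
  rw [← Equiv.prod_comp e, Fintype.prod_sum_type, Fintype.prod_prod_type]
  simp only [Finset.prod_mul_distrib, Fintype.prod_bool]
  simp [e2]
  ring

lemma sum_congruence (e : ι ⊕ κ × Bool ≃ M) (V : ι → M → ℤ) (B : M → M → ℤ) (P : Matrix M M ℤ) :
    ∑ τ, sTerm e (cV P V) (cB P B) τ = P.det * ∑ τ, sTerm e V B τ := by
  unfold sTerm
  rw [← tensor_congr]
  simp_rw [hTerm_congr]

def fl (e : ι ⊕ κ × Bool ≃ M) : Equiv.Perm M :=
  e.permCongr (Equiv.sumCongr (Equiv.refl ι) (Equiv.prodCongr (Equiv.refl κ) Equiv.boolNot))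

@[simp] lemma fl_inl (e : ι ⊕ κ × Bool ≃ M) (b : ι) : fl e (e (Sum.inl b)) = e (Sum.inl b) := by
  simp [fl]

@[simp] lemma fl_inr (e : ι ⊕ κ × Bool ≃ M) (a : κ) (β : Bool) :
    fl e (e (Sum.inr (a, β))) = e (Sum.inr (a, !β)) := by
  simp [fl]

lemma fl_fl (e : ι ⊕ κ × Bool ≃ M) (i : M) : fl e (fl e i) = i := by
  obtain ⟨z, rfl⟩ := e.surjective i
  rcases z with b | ⟨a, β⟩ <;> simp

def InW (e : ι ⊕ κ × Bool ≃ M) (w : Equiv.Perm M) : Prop :=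
  (∀ b, w (e (Sum.inl b)) = e (Sum.inl b)) ∧ ∀ i, w (fl e i) = fl e (w i)

lemma sTerm_inv (e : ι ⊕ κ × Bool ≃ M) (V : ι → M → ℤ) (B : M → M → ℤ)
    (hB : ∀ i j, B i j = - B j i) (w : Equiv.Perm M) (hw : InW e w) (t : Equiv.Perm M) :
    sTerm e V B (t * w) = sTerm e V B t := by
  obtain ⟨h1, h2⟩ := hw
  have hex : ∀ a, ∃ q : κ × Bool, w (e (Sum.inr (a, false))) = e (Sum.inr q) := by
    intro a
    obtain ⟨z, hz⟩ := e.surjective (w (e (Sum.inr (a, false))))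
    rcases z with b | q
    · rw [← h1 b] at hz
      have := e.injective (w.injective hz)
      simp at this
    · exact ⟨q, hz.symm⟩
  choose q hq using hex
  have hq' : ∀ a, w (e (Sum.inr (a, true))) = e (Sum.inr ((q a).1, !(q a).2)) := by
    intro a
    have := h2 (e (Sum.inr (a, false)))
    rw [fl_inr, hq, show q a = ((q a).1, (q a).2) from rfl, fl_inr] at this
    simpa using this
  have hinj : Function.Injective (fun a => (q a).1) := by
    intro a a' h
    simp only at h
    by_cases hb : (q a).2 = (q a').2
    · have : q a = q a' := Prod.ext h hb
      have h3 := (hq a).trans (this ▸ (hq a').symm)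
      simpa using e.injective (w.injective h3)
    · have : q a = ((q a').1, !(q a').2) := Prod.ext h (by
        cases h5 : (q a).2 <;> cases h6 : (q a').2 <;> simp_all)
      have h3 := (hq a).trans (this ▸ (hq' a').symm)
      simpa using e.injective (w.injective h3)
  let ρ : Equiv.Perm κ := Equiv.ofBijective _ (Finite.injective_iff_bijective.1 hinj)
  have hρ : ∀ a, ρ a = (q a).1 := fun a => rfl
  let ε : κ → Equiv.Perm Bool := fun a => if (q a).2 then Equiv.swap false true else 1
  have hwe : w = e.permCongr (Equiv.Perm.sumCongr 1
      (Equiv.prodCongrLeft (fun _ : Bool => ρ) * Equiv.prodCongrRight ε)) := by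
    ext i
    obtain ⟨z, rfl⟩ := e.surjective i
    rcases z with b | ⟨a, β⟩
    · simp [h1]
    · have : w (e (Sum.inr (a, β))) = e (Sum.inr (ρ a, ε a β)) := by
        cases β
        · rw [hq, hρ]
          congr 2
          refine Prod.ext rfl ?_
          simp only [ε]
          cases (q a).2 <;> simp
        · rw [hq', hρ]
          congr 2
          refine Prod.ext rfl ?_
          simp only [ε]
          cases (q a).2 <;> simp
      rw [this]
      simp
  have hsign : (Equiv.Perm.sign w : ℤ) = ∏ a, if (q a).2 then (-1 : ℤ) else 1 := by
    rw [hwe, Equiv.Perm.sign_permCongr, Equiv.Perm.sign_sumCongr, Equiv.Perm.sign_mul,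
      Equiv.Perm.sign_prodCongrLeft, Equiv.Perm.sign_prodCongrRight]
    simp only [Fintype.prod_bool, Int.units_mul_self, map_one, one_mul]
    rw [Units.coe_prod]
    refine Finset.prod_congr rfl fun a _ => ?_
    simp only [ε]
    split_ifs
    · rw [Equiv.Perm.sign_swap (by simp)]; simp
    · simp
  have hprod : ∏ a, B (t (w (e (Sum.inr (a, false))))) (t (w (e (Sum.inr (a, true))))) =
      (∏ a, if (q a).2 then (-1 : ℤ) else 1) *
        ∏ a, B (t (e (Sum.inr (a, false)))) (t (e (Sum.inr (a, true)))) := by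
    rw [← Equiv.prod_comp ρ (fun a => B (t (e (Sum.inr (a, false)))) (t (e (Sum.inr (a, true))))),
      ← Finset.prod_mul_distrib]
    refine Finset.prod_congr rfl fun a _ => ?_
    rw [hq, hq', hρ, show q a = ((q a).1, (q a).2) from rfl]
    cases (q a).2
    · simp
    · simp only [Bool.not_true, ↓reduceIte]
      rw [hB]; ring
  have hsq : (∏ a, if (q a).2 then (-1 : ℤ) else 1) * (∏ a, if (q a).2 then (-1 : ℤ) else 1) = 1 := by
    rw [← Finset.prod_mul_distrib]
    apply Finset.prod_eq_one
    intro a _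
    split_ifs <;> simp
  unfold sTerm hTerm
  simp only [Equiv.Perm.mul_apply, Equiv.Perm.sign_mul, Units.val_mul]
  simp_rw [h1]
  rw [hprod, hsign]
  linear_combination ((Equiv.Perm.sign t : ℤ) * (∏ b, V b (t (e (Sum.inl b)))) *
    ∏ a, B (t (e (Sum.inr (a, false)))) (t (e (Sum.inr (a, true))))) * hsq

def InT [LinearOrder κ] [LinearOrder M] (e : ι ⊕ κ × Bool ≃ M) (t : Equiv.Perm M) : Prop :=
  (∀ a, t (e (Sum.inr (a, false))) < t (e (Sum.inr (a, true)))) ∧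
    StrictMono (fun a => t (e (Sum.inr (a, false))))

lemma InW.of_eq (e : ι ⊕ κ × Bool ≃ M) (s t : Equiv.Perm M)
    (h1 : ∀ b, s (e (Sum.inl b)) = t (e (Sum.inl b)))
    (h2 : ∀ i, s (fl e (s⁻¹ i)) = t (fl e (t⁻¹ i))) : InW e (s⁻¹ * t) := by
  refine ⟨fun b => ?_, fun i => ?_⟩
  · simp [← h1]
  · simp only [Equiv.Perm.mul_apply]
    rw [Equiv.Perm.inv_eq_iff_eq, h2]
    simp

lemma InW.eq2 (e : ι ⊕ κ × Bool ≃ M) (s t : Equiv.Perm M) (h : InW e (s⁻¹ * t)) (i : M) :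
    s (fl e (s⁻¹ i)) = t (fl e (t⁻¹ i)) := by
  have := h.2 (t⁻¹ i)
  simp only [Equiv.Perm.mul_apply] at this
  rw [Equiv.Perm.inv_eq_iff_eq, show t (t⁻¹ i) = i from t.apply_symm_apply i] at this
  exact this.symm

lemma InW.eq1 (e : ι ⊕ κ × Bool ≃ M) (s t : Equiv.Perm M) (h : InW e (s⁻¹ * t)) (b : ι) :
    s (e (Sum.inl b)) = t (e (Sum.inl b)) := by
  have := h.1 b
  simp only [Equiv.Perm.mul_apply] at this
  rw [Equiv.Perm.inv_eq_iff_eq] at this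
  exact this.symm

lemma range_T [LinearOrder κ] [LinearOrder M] (e : ι ⊕ κ × Bool ≃ M) (t : Equiv.Perm M)
    (ht : InT e t) : Set.range (fun a => t (e (Sum.inr (a, false)))) =
      {i | i < t (fl e (t⁻¹ i))} := by
  ext i
  simp only [Set.mem_range, Set.mem_ofPred_eq]
  constructor
  · rintro ⟨a, rfl⟩
    simpa using ht.1 a
  · intro h
    obtain ⟨z, hz⟩ := e.surjective (t⁻¹ i)
    have hi : i = t (e z) := by rw [hz]; simp
    rcases z with b | ⟨a, (_ | _)⟩
    · rw [← hz] at h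
      simp [hi] at h
    · exact ⟨a, hi.symm⟩
    · rw [← hz] at h
      simp only [fl_inr, Bool.not_true] at h
      rw [hi] at h
      exact absurd (ht.1 a) (not_lt.2 h.le)

lemma T_unique [LinearOrder κ] [LinearOrder M] (e : ι ⊕ κ × Bool ≃ M) (s t : Equiv.Perm M)
    (hs : InT e s) (ht : InT e t) (h : InW e (s⁻¹ * t)) : s = t := by
  have h3 : (fun a => s (e (Sum.inr (a, false)))) = (fun a => t (e (Sum.inr (a, false)))) := by
    rw [← StrictMono.range_inj hs.2 ht.2, range_T e s hs, range_T e t ht]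
    simp_rw [h.eq2]
  ext i
  obtain ⟨z, rfl⟩ := e.surjective i
  rcases z with b | ⟨a, (_ | _)⟩
  · exact h.eq1 e s t b
  · exact congrFun h3 a
  · have h4 := h.eq2 e s t (s (e (Sum.inr (a, false))))
    have h5 := congrFun h3 a
    conv_rhs at h4 => rw [h5]
    simpa using h4

lemma T_exists {k : ℕ} [LinearOrder M] (e : ι ⊕ Fin k × Bool ≃ M) (t : Equiv.Perm M) :
    ∃ s, InT e s ∧ InW e (s⁻¹ * t) := by
  classical
  let pr : M → M := fun i => t (fl e (t⁻¹ i))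
  have hpr : ∀ i, pr (pr i) = i := by intro i; simp [pr, fl_fl]
  let S : Finset M := Finset.univ.filter fun i => i < pr i
  let u : Fin k → M := fun a => min (t (e (Sum.inr (a, false)))) (t (e (Sum.inr (a, true))))
  have hpx : ∀ a β, pr (t (e (Sum.inr (a, β)))) = t (e (Sum.inr (a, !β))) := by
    intro a β; simp [pr]
  have hne : ∀ a β, t (e (Sum.inr (a, β))) ≠ t (e (Sum.inr (a, !β))) := by
    intro a β h
    have := e.injective (t.injective h)
    simp at this
  have hS : S = Finset.univ.image u := by
    ext i
    simp only [S, Finset.mem_filter, Finset.mem_univ, true_and, Finset.mem_image]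
    constructor
    · intro h
      obtain ⟨z, hz⟩ := e.surjective (t⁻¹ i)
      have hi : i = t (e z) := by rw [hz]; simp
      rcases z with b | ⟨a, β⟩
      · simp [hi, pr] at h
      · refine ⟨a, ?_⟩
        rw [hi, hpx] at h
        rw [hi]
        cases β
        · exact min_eq_left h.le
        · exact min_eq_right h.le
    · rintro ⟨a, rfl⟩
      rcases lt_or_gt_of_ne (hne a false) with h | h
      · have : u a = t (e (Sum.inr (a, false))) := min_eq_left h.le
        rw [this, hpx]; exact h
      · have : u a = t (e (Sum.inr (a, true))) := min_eq_right h.le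
        rw [this, hpx]; exact h
  have hu : Function.Injective u := by
    intro a a' h
    have : ∃ β β', t (e (Sum.inr (a, β))) = t (e (Sum.inr (a', β'))) := by
      rcases min_choice (t (e (Sum.inr (a, false)))) (t (e (Sum.inr (a, true)))) with h1 | h1 <;>
      rcases min_choice (t (e (Sum.inr (a', false)))) (t (e (Sum.inr (a', true)))) with h2 | h2
      · exact ⟨false, false, by rw [← h1, ← h2]; exact h⟩
      · exact ⟨false, true, by rw [← h1, ← h2]; exact h⟩
      · exact ⟨true, false, by rw [← h1, ← h2]; exact h⟩
      · exact ⟨true, true, by rw [← h1, ← h2]; exact h⟩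
    obtain ⟨β, β', h3⟩ := this
    have := e.injective (t.injective h3)
    simp at this
    exact this.1
  have hcard : S.card = k := by
    rw [hS, Finset.card_image_of_injective _ hu]; simp
  let v := S.orderEmbOfFin hcard
  have hv : ∀ a, v a < pr (v a) := by
    intro a
    have := Finset.orderEmbOfFin_mem S hcard a
    exact (Finset.mem_filter.1 this).2
  have hvr : ∀ a, ∃ a' β, v a = t (e (Sum.inr (a', β))) := by
    intro a
    obtain ⟨z, hz⟩ := e.surjective (t⁻¹ (v a))
    have hi : v a = t (e z) := by rw [hz]; simp
    rcases z with b | ⟨a', β⟩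
    · have := hv a
      rw [hi] at this
      simp [pr] at this
    · exact ⟨a', β, hi⟩
  let F : ι ⊕ Fin k × Bool → M := fun z => match z with
    | Sum.inl b => t (e (Sum.inl b))
    | Sum.inr (a, false) => v a
    | Sum.inr (a, true) => pr (v a)
  have hprinl : ∀ b, pr (t (e (Sum.inl b))) = t (e (Sum.inl b)) := by intro b; simp [pr]
  have hF : Function.Injective F := by
    intro z z' h
    rcases z with b | ⟨a, (_ | _)⟩ <;> rcases z' with b' | ⟨a', (_ | _)⟩ <;> simp only [F] at h
    · rw [e.injective (t.injective h)]
    · have := hv a'; rw [← h, hprinl] at this; exact absurd this (lt_irrefl _)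
    · have := hv a'; rw [← h] at this
      have h2 : v a' = pr (t (e (Sum.inl b))) := by rw [h, hpr]
      rw [h2, hprinl] at this; exact absurd this (lt_irrefl _)
    · have := hv a; rw [h, hprinl] at this; exact absurd this (lt_irrefl _)
    · rw [v.injective h]
    · have h1 := hv a; have h2 := hv a'
      rw [h, hpr] at h1
      exact absurd h2 (not_lt.2 h1.le)
    · have := hv a; rw [h] at this
      have h2 : v a = pr (t (e (Sum.inl b'))) := by rw [← h, hpr]
      rw [h2, hprinl] at this; exact absurd this (lt_irrefl _)
    · have h1 := hv a; have h2 := hv a'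
      rw [← h, hpr] at h2
      exact absurd h2 (not_lt.2 h1.le)
    · have : v a = v a' := by rw [← hpr (v a), h, hpr]
      rw [v.injective this]
  have hG : Function.Injective (F ∘ e.symm) := hF.comp e.symm.injective
  let s : Equiv.Perm M := Equiv.ofBijective _ (Finite.injective_iff_bijective.1 hG)
  have hsz : ∀ z, s (e z) = F z := by intro z; simp [s]
  refine ⟨s, ⟨fun a => ?_, fun a a' haa => ?_⟩, InW.of_eq e s t (fun b => ?_) (fun i => ?_)⟩
  · rw [hsz, hsz]; exact hv a
  · simp only [hsz]; exact v.strictMono haa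
  · rw [hsz]
  · obtain ⟨z, hz⟩ := (e.trans s).surjective i
    simp only [Equiv.trans_apply] at hz
    subst hz
    change _ = pr _
    rw [show s⁻¹ (s (e z)) = e z from s.symm_apply_apply _]
    rcases z with b | ⟨a, (_ | _)⟩
    · rw [fl_inl, hsz]; simp only [F]; rw [hprinl]
    · rw [fl_inr, hsz, hsz]; simp [F]
    · rw [fl_inr, hsz, hsz]; simp [F, hpr]

open Classical in
noncomputable def hSum {k : ℕ} [LinearOrder M] (e : ι ⊕ Fin k × Bool ≃ M) (V : ι → M → ℤ)
    (B : M → M → ℤ) : ℤ :=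
  ∑ t ∈ Finset.univ.filter (fun t => InT e t), sTerm e V B t

open Classical in
lemma full_eq {k : ℕ} [LinearOrder M] (e : ι ⊕ Fin k × Bool ≃ M) (V : ι → M → ℤ)
    (B : M → M → ℤ) (hB : ∀ i j, B i j = - B j i) :
    ∑ τ, sTerm e V B τ =
      ((Finset.univ.filter fun w : Equiv.Perm M => InW e w).card : ℤ) * hSum e V B := by
  have h1 : ∀ τ, sTerm e V B τ = ∑ t ∈ Finset.univ.filter (fun t => InT e t),
      if InW e (t⁻¹ * τ) then sTerm e V B τ else 0 := by
    intro τ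
    obtain ⟨s, hs, hw⟩ := T_exists e τ
    rw [Finset.sum_eq_single s]
    · rw [if_pos hw]
    · intro t ht hts
      rw [if_neg]
      intro h
      apply hts
      refine T_unique e t s (by simpa using ht) hs ?_
      refine InW.of_eq e _ _ (fun b => ?_) (fun i => ?_)
      · rw [h.eq1, hw.eq1]
      · rw [h.eq2, hw.eq2]
    · intro h; exact absurd (by simpa using hs) h
  rw [Finset.sum_congr rfl fun τ _ => h1 τ, Finset.sum_comm, hSum, Finset.mul_sum]
  refine Finset.sum_congr rfl fun t _ => ?_
  rw [← Equiv.sum_comp (Equiv.mulLeft t)]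
  simp only [Equiv.coe_mulLeft, inv_mul_cancel_left]
  rw [← Finset.sum_filter]
  rw [Finset.sum_congr rfl (g := fun _ => sTerm e V B t)]
  · simp
  · intro w hw
    exact sTerm_inv e V B hB w (by simpa using hw) t

open Classical in
lemma W_card_ne (e : ι ⊕ κ × Bool ≃ M) :
    ((Finset.univ.filter fun w : Equiv.Perm M => InW e w).card : ℤ) ≠ 0 := by
  have : (1 : Equiv.Perm M) ∈ (Finset.univ.filter fun w : Equiv.Perm M => InW e w) := by
    rw [Finset.mem_filter]
    exact ⟨Finset.mem_univ _, by simp [InW]⟩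
  exact_mod_cast (Finset.card_pos.2 ⟨_, this⟩).ne'

lemma cB_skew (P : Matrix M M ℤ) (B : M → M → ℤ) (hB : ∀ i j, B i j = - B j i) (i j : M) :
    cB P B i j = - cB P B j i := by
  unfold cB
  simp_rw [Finset.mul_sum]
  rw [Finset.sum_comm, ← Finset.sum_neg_distrib]
  refine Finset.sum_congr rfl fun k _ => ?_
  rw [← Finset.sum_neg_distrib]
  refine Finset.sum_congr rfl fun l _ => ?_
  rw [hB l k]; ring

lemma hSum_congruence {k : ℕ} [LinearOrder M] (e : ι ⊕ Fin k × Bool ≃ M) (V : ι → M → ℤ)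
    (B : M → M → ℤ) (hB : ∀ i j, B i j = - B j i) (P : Matrix M M ℤ) (hP : P.det = 1) :
    hSum e V B = hSum e (cV P V) (cB P B) := by
  have h := sum_congruence e V B P
  rw [full_eq e V B hB, full_eq e _ _ (cB_skew P B hB), hP, one_mul] at h
  exact (mul_left_cancel₀ (W_card_ne e) h).symm

lemma hSum_zero {k : ℕ} [LinearOrder M] (e : ι ⊕ Fin k × Bool ≃ M) (V : ι → M → ℤ)
    (B : M → M → ℤ) (h : ∀ t : Equiv.Perm M, hTerm e V B t = 0) : hSum e V B = 0 := by
  unfold hSum sTerm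
  apply Finset.sum_eq_zero
  intro t _
  rw [h, mul_zero]

lemma hSum_single {k : ℕ} [LinearOrder M] (e : ι ⊕ Fin k × Bool ≃ M) (V : ι → M → ℤ)
    (B : M → M → ℤ) (hB : ∀ i j, B i j = - B j i) (t : Equiv.Perm M)
    (h : ∀ s : Equiv.Perm M, hTerm e V B s ≠ 0 → InW e (t⁻¹ * s)) :
    hSum e V B = sTerm e V B t := by
  classical
  have h1 := full_eq e V B hB
  rw [← Equiv.sum_comp (Equiv.mulLeft t)] at h1
  simp only [Equiv.coe_mulLeft] at h1
  rw [← Finset.sum_subset (Finset.subset_univ (Finset.univ.filter fun w => InW e w)),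
    Finset.sum_congr rfl (g := fun _ => sTerm e V B t)] at h1
  · simp only [Finset.sum_const, nsmul_eq_mul] at h1
    exact (mul_left_cancel₀ (W_card_ne e) h1).symm
  · intro w hw
    exact sTerm_inv e V B hB w (by simpa using hw) t
  · intro w _ hw
    unfold sTerm
    by_contra h2
    apply hw
    have := h (t * w) (right_ne_zero_of_mul h2)
    simpa using this

end Part1

section Part2

/-- Abstract data: elements of an ordered set are distributed into groups and ranked. -/
structure RD (M : Type*) [LinearOrder M] (N : Type*) where
  c : M → N
  grp : M → ℕ
  rk : M → ℕ
  ct : ℕ → ℕ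
  rk_lt : ∀ i, rk i < ct (grp i)
  lt_iff : ∀ i j, grp i = grp j → (rk i < rk j ↔ i < j)
  surj : ∀ r s, s < ct r → ∃ i, grp i = r ∧ rk i = s
  grp_c : ∀ i j, c i = c j → grp i = grp j
  par : ∀ i j, grp i = grp j → (c i = c j ↔ rk i % 2 = rk j % 2)

variable {ι M N : Type*} [Fintype ι] [DecidableEq ι] [Fintype M] [LinearOrder M] [DecidableEq N]

lemma RD.inj (D : RD M N) (i j : M) (h : D.grp i = D.grp j) (h2 : D.rk i = D.rk j) : i = j := by
  rcases lt_trichotomy i j with h3 | h3 | h3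
  · have := (D.lt_iff i j h).2 h3; omega
  · exact h3
  · have := (D.lt_iff j i h.symm).2 h3; omega

def RD.B (D : RD M N) (i j : M) : ℤ :=
  if D.grp i = D.grp j ∧ (D.rk i + D.rk j) % 2 = 1 then (if D.rk i < D.rk j then 1 else -1) else 0

def RD.V (D : RD M N) (f : ι → N) (b : ι) (i : M) : ℤ := if D.c i = f b then 1 else 0

def RD.P (D : RD M N) : Matrix M M ℤ := fun i j =>
  (if i = j then 1 else 0) - (if D.grp i = D.grp j ∧ D.rk j = D.rk i + 2 then 1 else 0)

def RD.B' (D : RD M N) (i j : M) : ℤ :=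
  if D.grp i = D.grp j ∧ (D.rk j = D.rk i + 1 ∨ D.rk i = D.rk j + 1) then
    (if D.rk i < D.rk j then 1 else -1) *
      (if min (D.rk i) (D.rk j) + 2 < D.ct (D.grp i) then 2 else 1) else 0

def RD.V' (D : RD M N) (f : ι → N) (b : ι) (i : M) : ℤ :=
  if D.c i = f b ∧ D.ct (D.grp i) ≤ D.rk i + 2 then 1 else 0

lemma RD.det_P (D : RD M N) : D.P.det = 1 := by
  rw [Matrix.det_of_isUpperTriangular]
  · apply Finset.prod_eq_one
    intro i _
    simp [RD.P]
  · intro i j hij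
    simp only [id] at hij
    simp only [RD.P]
    rw [if_neg hij.ne', if_neg]
    · simp
    · rintro ⟨h1, h2⟩
      have := (D.lt_iff i j h1).1 (by omega)
      exact absurd hij (not_lt.2 this.le)

lemma RD.sum_P_some (D : RD M N) (F : M → ℤ) (i k : M) (h : D.grp k = D.grp i)
    (h2 : D.rk k = D.rk i + 2) : ∑ j, D.P i j * F j = F i - F k := by
  have : ∀ j, D.P i j * F j = (if i = j then F j else 0) - (if k = j then F j else 0) := by
    intro j
    have : (D.grp i = D.grp j ∧ D.rk j = D.rk i + 2) ↔ k = j := by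
      constructor
      · rintro ⟨h3, h4⟩
        exact D.inj k j (h.trans h3) (h2.trans h4.symm)
      · rintro rfl
        exact ⟨h.symm, h2⟩
    simp only [RD.P, this, sub_mul, ite_mul, one_mul, zero_mul]
  simp [this]

lemma RD.sum_P_none (D : RD M N) (F : M → ℤ) (i : M) (h : D.ct (D.grp i) ≤ D.rk i + 2) :
    ∑ j, D.P i j * F j = F i := by
  have : ∀ j, D.P i j * F j = (if i = j then F j else 0) := by
    intro j
    have : ¬ (D.grp i = D.grp j ∧ D.rk j = D.rk i + 2) := by
      rintro ⟨h3, h4⟩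
      have := D.rk_lt j
      rw [← h3] at this
      omega
    simp [RD.P, this]
  simp [this]

lemma RD.B_skew (D : RD M N) (i j : M) : D.B i j = - D.B j i := by
  unfold RD.B
  by_cases h : D.grp i = D.grp j ∧ (D.rk i + D.rk j) % 2 = 1
  · rw [if_pos h, if_pos (⟨h.1.symm, by omega⟩ : D.grp j = D.grp i ∧ (D.rk j + D.rk i) % 2 = 1)]
    have := h.2
    split_ifs <;> omega
  · rw [if_neg h, if_neg]
    · simp
    · rintro ⟨h1, h2⟩
      exact h ⟨h1.symm, by omega⟩

lemma RD.cV_eq (D : RD M N) (f : ι → N) : cV D.P (D.V f) = D.V' f := by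
  funext b i
  unfold cV
  by_cases h : D.ct (D.grp i) ≤ D.rk i + 2
  · rw [D.sum_P_none _ _ h]
    simp [RD.V, RD.V', h]
  · obtain ⟨k, hk1, hk2⟩ := D.surj (D.grp i) (D.rk i + 2) (by omega)
    rw [D.sum_P_some _ i k hk1 hk2]
    have : D.c k = D.c i := (D.par k i hk1).2 (by omega)
    simp [RD.V, RD.V', h, this]

lemma RD.B_diff (D : RD M N) (i k j : M) (h : D.grp i = D.grp k) (h2 : D.rk k = D.rk i + 2)
    (hg : D.grp i = D.grp j) : D.B i j - D.B k j = if D.rk j = D.rk i + 1 then 2 else 0 := by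
  simp only [RD.B, ← h, h2, hg, true_and]
  split_ifs <;> omega

lemma RD.cB_eq (D : RD M N) : cB D.P D.B = D.B' := by
  funext i j
  unfold cB
  by_cases hg : D.grp i = D.grp j
  · have hi := D.rk_lt i
    have hj := D.rk_lt j
    by_cases h : D.ct (D.grp i) ≤ D.rk i + 2
    · rw [D.sum_P_none _ _ h]
      by_cases h' : D.ct (D.grp j) ≤ D.rk j + 2
      · rw [D.sum_P_none _ _ h']
        rw [hg] at h hi
        simp only [RD.B, RD.B', hg, true_and]
        split_ifs <;> omega
      · obtain ⟨l, hl1, hl2⟩ := D.surj (D.grp j) (D.rk j + 2) (by omega)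
        rw [D.sum_P_some _ j l hl1 hl2]
        rw [hg] at h hi
        simp only [RD.B, RD.B', hg, hl1, hl2, true_and]
        split_ifs <;> omega
    · obtain ⟨k, hk1, hk2⟩ := D.surj (D.grp i) (D.rk i + 2) (by omega)
      rw [D.sum_P_some _ i k hk1 hk2]
      rw [hg] at h hi hk1
      by_cases h' : D.ct (D.grp j) ≤ D.rk j + 2
      · rw [D.sum_P_none _ _ h', D.sum_P_none _ _ h']
        simp only [RD.B, RD.B', hg, hk1, hk2, true_and]
        split_ifs <;> omega
      · obtain ⟨l, hl1, hl2⟩ := D.surj (D.grp j) (D.rk j + 2) (by omega)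
        rw [D.sum_P_some _ j l hl1 hl2, D.sum_P_some _ j l hl1 hl2]
        have e1 := D.B_diff i k j (hg.trans hk1.symm) (by omega) hg
        have e2 := D.B_diff i k l (hg.trans hk1.symm) (by omega) (hg.trans hl1.symm)
        have e3 : D.B i j - D.B i l - (D.B k j - D.B k l) =
          (if D.rk j = D.rk i + 1 then 2 else 0) - (if D.rk l = D.rk i + 1 then 2 else 0) := by
          rw [← e1, ← e2]; ring
        rw [e3]
        simp only [RD.B', hg, hl2, true_and]
        split_ifs <;> omega
  · rw [RD.B', if_neg (fun h => hg h.1)]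
    apply Finset.sum_eq_zero
    intro k _
    rw [Finset.mul_sum]
    apply Finset.sum_eq_zero
    intro l _
    by_cases hk : D.grp i = D.grp k
    · by_cases hl : D.grp j = D.grp l
      · have : ¬ D.grp k = D.grp l := by rw [← hk, ← hl]; exact hg
        simp [RD.B, this]
      · have : D.P j l = 0 := by
          rw [RD.P, if_neg, if_neg (fun h => hl h.1)]
          · simp
          · rintro rfl; exact hl rfl
        simp [this]
    · have : D.P i k = 0 := by
        rw [RD.P, if_neg, if_neg (fun h => hk h.1)]
        · simp
        · rintro rfl; exact hk rfl
      simp [this]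

variable {k : ℕ}

lemma RD.B'_skew (D : RD M N) (i j : M) : D.B' i j = - D.B' j i := by
  rw [← RD.cB_eq]
  exact cB_skew _ _ D.B_skew i j

lemma RD.hSum_eq (D : RD M N) (e : ι ⊕ Fin k × Bool ≃ M) (f : ι → N) :
    hSum e (D.V f) D.B = hSum e (D.V' f) D.B' := by
  rw [hSum_congruence e _ _ D.B_skew D.P D.det_P, D.cV_eq, D.cB_eq]

/-- consequences of a nonzero term -/
lemma RD.nz_V (D : RD M N) (e : ι ⊕ Fin k × Bool ≃ M) (f : ι → N) (t : M → M)
    (h : hTerm e (D.V' f) D.B' t ≠ 0) (b : ι) :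
    D.c (t (e (Sum.inl b))) = f b ∧
      D.ct (D.grp (t (e (Sum.inl b)))) ≤ D.rk (t (e (Sum.inl b))) + 2 := by
  have := Finset.prod_ne_zero_iff.1 (left_ne_zero_of_mul h) b (Finset.mem_univ _)
  simp only [RD.V'] at this
  by_contra h2
  rw [if_neg h2] at this
  exact this rfl

lemma RD.nz_B (D : RD M N) (e : ι ⊕ Fin k × Bool ≃ M) (f : ι → N) (t : M → M)
    (h : hTerm e (D.V' f) D.B' t ≠ 0) (a : Fin k) (β : Bool) :
    D.grp (t (e (Sum.inr (a, β)))) = D.grp (t (e (Sum.inr (a, !β)))) ∧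
    (D.rk (t (e (Sum.inr (a, !β)))) = D.rk (t (e (Sum.inr (a, β)))) + 1 ∨
      D.rk (t (e (Sum.inr (a, β)))) = D.rk (t (e (Sum.inr (a, !β)))) + 1) := by
  have := Finset.prod_ne_zero_iff.1 (right_ne_zero_of_mul h) a (Finset.mem_univ _)
  simp only [RD.B'] at this
  by_contra h2
  rw [if_neg] at this
  · exact this rfl
  · intro h3
    apply h2
    cases β
    · exact h3
    · exact ⟨h3.1.symm, h3.2.symm⟩

lemma RD.nz_pair (D : RD M N) (e : ι ⊕ Fin k × Bool ≃ M) (f : ι → N) (t : Equiv.Perm M)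
    (h : hTerm e (D.V' f) D.B' t ≠ 0) : ∀ s a β, D.rk (t (e (Sum.inr (a, β)))) / 2 = s →
      D.rk (t (e (Sum.inr (a, !β)))) / 2 = s := by
  intro s
  induction s using Nat.strong_induction_on with
  | _ s ih =>
    have key : ∀ a β, D.rk (t (e (Sum.inr (a, β)))) = 2 * s →
        D.rk (t (e (Sum.inr (a, !β)))) = 2 * s + 1 := by
      intro a β hr
      obtain ⟨hg, h1 | h1⟩ := D.nz_B e f t h a β
      · omega
      · have := ih (s - 1) (by omega) a (!β) (by omega)
        rw [Bool.not_not] at this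
        omega
    intro a β hr
    by_cases h2 : D.rk (t (e (Sum.inr (a, β)))) = 2 * s
    · have := key a β h2
      omega
    · have h3 : D.rk (t (e (Sum.inr (a, β)))) = 2 * s + 1 := by omega
      obtain ⟨hg, h1 | h1⟩ := D.nz_B e f t h a β
      · exfalso
        have hlt := D.rk_lt (t (e (Sum.inr (a, !β))))
        obtain ⟨l, hl1, hl2⟩ := D.surj (D.grp (t (e (Sum.inr (a, !β))))) (2 * s) (by omega)
        obtain ⟨z, rfl⟩ := (e.trans t).surjective l
        simp only [Equiv.trans_apply] at hl1 hl2
        rcases z with b | ⟨a', β'⟩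
        · have := (D.nz_V e f t h b).2
          rw [hl1] at this
          omega
        · have h4 := key a' β' hl2
          have h5 := (D.nz_B e f t h a' β').1
          have h6 := D.inj (t (e (Sum.inr (a', !β')))) (t (e (Sum.inr (a, β))))
            (by rw [← h5, hl1, hg]) (by omega)
          have h7 := e.injective (t.injective h6)
          simp only [Sum.inr.injEq, Prod.mk.injEq] at h7
          obtain ⟨rfl, rfl⟩ := h7
          simp only [Bool.not_not] at h1
          omega
      · omega

lemma RD.last_unique (D : RD M N) (i j : M) (h : D.c i = D.c j)
    (hi : D.ct (D.grp i) ≤ D.rk i + 2) (hj : D.ct (D.grp j) ≤ D.rk j + 2) : i = j := by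
  have hg := D.grp_c i j h
  have h2 := (D.par i j hg).1 h
  have h3 := D.rk_lt i
  have h4 := D.rk_lt j
  rw [hg] at hi h3
  exact D.inj i j hg (by omega)

/-- description of the matching -/
lemma RD.nz_mate (D : RD M N) (e : ι ⊕ Fin k × Bool ≃ M) (f : ι → N) (t : Equiv.Perm M)
    (h : hTerm e (D.V' f) D.B' t ≠ 0) (a : Fin k) (β : Bool) (j : M)
    (hj : D.grp j = D.grp (t (e (Sum.inr (a, β)))))
    (hj2 : D.rk j / 2 = D.rk (t (e (Sum.inr (a, β)))) / 2) (hne : j ≠ t (e (Sum.inr (a, β)))) :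
    t (e (Sum.inr (a, !β))) = j := by
  have h1 := D.nz_pair e f t h _ a β rfl
  obtain ⟨h2, h3⟩ := D.nz_B e f t h a β
  have h4 : D.rk j ≠ D.rk (t (e (Sum.inr (a, β)))) := fun h5 => hne (D.inj _ _ hj h5)
  exact D.inj _ _ (h2.symm.trans hj.symm) (by omega)

lemma RD.nz_unique (D : RD M N) (e : ι ⊕ Fin k × Bool ≃ M) (f : ι → N) (s t : Equiv.Perm M)
    (hs : hTerm e (D.V' f) D.B' s ≠ 0) (ht : hTerm e (D.V' f) D.B' t ≠ 0) : InW e (s⁻¹ * t) := by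
  have h1 : ∀ b, s (e (Sum.inl b)) = t (e (Sum.inl b)) := by
    intro b
    have a1 := D.nz_V e f s hs b
    have a2 := D.nz_V e f t ht b
    exact D.last_unique _ _ (a1.1.trans a2.1.symm) a1.2 a2.2
  refine InW.of_eq e s t h1 ?_
  intro i
  obtain ⟨z, rfl⟩ := (e.trans s).surjective i
  simp only [Equiv.trans_apply]
  rw [show s⁻¹ (s (e z)) = e z from s.symm_apply_apply _]
  rcases z with b | ⟨a, β⟩
  · rw [h1, show t⁻¹ (t (e (Sum.inl b))) = _ from t.symm_apply_apply _, fl_inl, h1]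
  · rw [fl_inr]
    obtain ⟨z, hz⟩ := (e.trans t).surjective (s (e (Sum.inr (a, β))))
    simp only [Equiv.trans_apply] at hz
    rcases z with b | ⟨a', β'⟩
    · rw [← h1] at hz
      have := e.injective (s.injective hz)
      simp at this
    · rw [← hz, show t⁻¹ (t (e (Sum.inr (a', β')))) = _ from t.symm_apply_apply _, fl_inr]
      obtain ⟨b1, b2⟩ := D.nz_B e f t ht a' β'
      refine D.nz_mate e f s hs a β _ ?_ ?_ ?_
      · rw [← b1, hz]
      · rw [D.nz_pair e f t ht _ a' β' rfl, hz]
      · rw [← hz]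
        intro h
        rw [h] at b2
        omega

lemma RD.hSum_cases (D : RD M N) (e : ι ⊕ Fin k × Bool ≃ M) (f : ι → N) :
    (hSum e (D.V f) D.B = 0 ∧ ∀ t : Equiv.Perm M, hTerm e (D.V' f) D.B' t = 0) ∨
    ∃ t : Equiv.Perm M, hTerm e (D.V' f) D.B' t ≠ 0 ∧
      (hSum e (D.V f) D.B).natAbs =
        2 ^ (Finset.univ.filter fun a : Fin k =>
          min (D.rk (t (e (Sum.inr (a, false))))) (D.rk (t (e (Sum.inr (a, true))))) + 2 <
            D.ct (D.grp (t (e (Sum.inr (a, false)))))).card := by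
  rw [D.hSum_eq]
  by_cases h : ∀ t : Equiv.Perm M, hTerm e (D.V' f) D.B' t = 0
  · exact Or.inl ⟨hSum_zero _ _ _ h, h⟩
  · push Not at h
    obtain ⟨t, ht⟩ := h
    refine Or.inr ⟨t, ht, ?_⟩
    rw [hSum_single e _ _ D.B'_skew t (fun s hs => D.nz_unique e f t s ht hs)]
    unfold sTerm hTerm
    rw [Int.natAbs_mul, Int.natAbs_mul, Int.units_natAbs, one_mul]
    have h1 : ∏ b, D.V' f b (t (e (Sum.inl b))) = 1 := by
      apply Finset.prod_eq_one
      intro b _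
      rw [RD.V', if_pos (D.nz_V e f t ht b)]
    rw [h1, Int.natAbs_one, one_mul, ← Int.natAbsHom_apply, map_prod]
    rw [← Finset.prod_const, Finset.prod_filter]
    refine Finset.prod_congr rfl fun a _ => ?_
    rw [RD.B', if_pos (by simpa using D.nz_B e f t ht a false)]
    rw [Int.natAbsHom_apply, Int.natAbs_mul]
    split_ifs <;> simp

end Part2

section Part3

variable {ι M : Type*} [Fintype ι] [DecidableEq ι] [Fintype M] [LinearOrder M] {k : ℕ}

lemma perm_of_bij {O : Type*} [Fintype O] (e : ι ⊕ Fin k × Bool ≃ M) (φ : ι ⊕ O × Bool → M)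
    (hφ : Function.Bijective φ) : ∃ (t : Equiv.Perm M) (θ : Fin k ≃ O),
      (∀ b, t (e (Sum.inl b)) = φ (Sum.inl b)) ∧
      ∀ a β, t (e (Sum.inr (a, β))) = φ (Sum.inr (θ a, β)) := by
  have h1 := Fintype.card_congr e
  have h2 := Fintype.card_congr (Equiv.ofBijective φ hφ)
  rw [← h1] at h2
  simp only [Fintype.card_sum, Fintype.card_prod, Fintype.card_fin, Fintype.card_bool] at h2
  have θ : Fin k ≃ O := Fintype.equivOfCardEq (by rw [Fintype.card_fin]; omega)
  refine ⟨e.symm.trans ((Equiv.sumCongr (Equiv.refl ι) (Equiv.prodCongr θ (Equiv.refl Bool))).trans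
    (Equiv.ofBijective φ hφ)), θ, ?_, ?_⟩ <;> intros <;> simp

variable {ν : ℕ}

lemma RD.exists_g [IsEmpty ι] (D : RD M (Fin (2 * ν))) (e : ι ⊕ Fin k × Bool ≃ M)
    (f : ι → Fin (2 * ν))
    (hgood : ∀ i, Even (D.ct (D.grp i))) :
    ∃ t : Equiv.Perm M, hTerm e (D.V' f) D.B' t ≠ 0 := by
  classical
  have hm : ∀ i : {i : M // D.rk i % 2 = 0}, ∃ j, D.grp j = D.grp i ∧ D.rk j = D.rk i + 1 := by
    intro i
    apply D.surj
    have h1 := D.rk_lt i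
    have h2 := (hgood i.1).two_dvd
    have h3 := i.2
    omega
  choose mate hm1 hm2 using hm
  let φ : ι ⊕ {i : M // D.rk i % 2 = 0} × Bool → M := fun z => match z with
    | Sum.inl b => isEmptyElim b
    | Sum.inr (i, false) => i.1
    | Sum.inr (i, true) => mate i
  have hφ : Function.Bijective φ := by
    constructor
    · intro z z' h
      rcases z with b | ⟨i, (_ | _)⟩
      · exact isEmptyElim b
      · rcases z' with b | ⟨i', (_ | _)⟩
        · exact isEmptyElim b
        · simp only [φ] at h; rw [Subtype.ext h]
        · simp only [φ] at h
          have h1 := hm2 i'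
          have h2 := i'.2
          have h3 := i.2
          rw [← h] at h1
          omega
      · rcases z' with b | ⟨i', (_ | _)⟩
        · exact isEmptyElim b
        · simp only [φ] at h
          have h1 := hm2 i
          have h2 := i'.2
          have h3 := i.2
          rw [h] at h1
          omega
        · simp only [φ] at h
          have h1 := hm2 i
          have h2 := hm2 i'
          have h3 := hm1 i
          have h4 := hm1 i'
          rw [h] at h1 h3
          have : i.1 = i'.1 := D.inj _ _ (by omega) (by omega)
          rw [Subtype.ext this]
    · intro j
      by_cases hj : D.rk j % 2 = 0
      · exact ⟨Sum.inr (⟨j, hj⟩, false), rfl⟩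
      · have h1 := D.rk_lt j
        obtain ⟨i, hi1, hi2⟩ := D.surj (D.grp j) (D.rk j - 1) (by omega)
        have hi3 : D.rk i % 2 = 0 := by omega
        refine ⟨Sum.inr (⟨i, hi3⟩, true), ?_⟩
        have h4 := hm1 ⟨i, hi3⟩
        have h5 := hm2 ⟨i, hi3⟩
        simp only at h4 h5
        exact D.inj _ _ (by simp only [φ]; omega) (by simp only [φ]; omega)
  obtain ⟨t, θ, ht1, ht2⟩ := perm_of_bij e φ hφ
  refine ⟨t, ?_⟩
  unfold hTerm
  rw [Finset.univ_eq_empty (α := ι), Finset.prod_empty, one_mul, Finset.prod_ne_zero_iff]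
  intro a _
  rw [ht2, ht2]
  simp only [φ]
  have h1 := hm1 (θ a)
  have h2 := hm2 (θ a)
  rw [RD.B', if_pos ⟨h1.symm, Or.inl h2⟩]
  split_ifs <;> simp

lemma RD.g_parity [IsEmpty ι] (D : RD M (Fin (2 * ν))) (e : ι ⊕ Fin k × Bool ≃ M)
    (f : ι → Fin (2 * ν)) (hc : ∀ i, D.grp i = (D.c i).1 / 2) (hk : ν ≤ k) (x : ℤ)
    (hx : 2 ^ (k - ν) * x = hSum e (D.V f) D.B) :
    Odd x ↔ ∀ r < ν, Even (D.ct r) ∧ 1 ≤ D.ct r := by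
  classical
  have hgl : ∀ i, D.grp i < ν := by
    intro i
    have := (D.c i).2
    rw [hc]; omega
  rcases D.hSum_cases e f with ⟨h0, hz⟩ | ⟨t, ht, habs⟩
  · rw [h0] at hx
    have hx0 : x = 0 := by
      rcases mul_eq_zero.1 hx with h | h
      · exact absurd h (by positivity)
      · exact h
    subst hx0
    simp only [Int.not_odd_zero, false_iff]
    intro h
    obtain ⟨t, ht⟩ := D.exists_g e f (fun i => (h _ (hgl i)).1)
    exact ht (hz t)
  · have heven : ∀ r, Even (D.ct r) := by
      intro r
      by_contra hodd
      rw [Nat.not_even_iff] at hodd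
      obtain ⟨i, hi1, hi2⟩ := D.surj r (D.ct r - 1) (by omega)
      obtain ⟨z, rfl⟩ := (e.trans t).surjective i
      simp only [Equiv.trans_apply] at hi1 hi2
      rcases z with b | ⟨a, β⟩
      · exact isEmptyElim b
      · have h1 := D.nz_pair e f t ht _ a β rfl
        have h2 := D.nz_B e f t ht a β
        have h3 := D.rk_lt (t (e (Sum.inr (a, !β))))
        rw [← h2.1, hi1] at h3
        omega
    set Q : Fin k → Prop := fun a =>
          min (D.rk (t (e (Sum.inr (a, false))))) (D.rk (t (e (Sum.inr (a, true))))) + 2 <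
            D.ct (D.grp (t (e (Sum.inr (a, false))))) with hQ
    have hcard := Finset.card_filter_add_card_filter_not (s := (Finset.univ : Finset (Fin k))) Q
    rw [Finset.card_univ, Fintype.card_fin] at hcard
    -- the non-doubled pairs inject into the nonempty groups
    have himg : (Finset.univ.filter fun a => ¬ Q a).image
        (fun a => D.grp (t (e (Sum.inr (a, false))))) =
        (Finset.range ν).filter (fun r => 1 ≤ D.ct r) := by
      ext r
      simp only [Finset.mem_image, Finset.mem_filter, Finset.mem_univ, true_and, Finset.mem_range]
      constructor
      · rintro ⟨a, _, rfl⟩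
        have := D.rk_lt (t (e (Sum.inr (a, false))))
        exact ⟨hgl _, by omega⟩
      · rintro ⟨hr, hr1⟩
        obtain ⟨i, hi1, hi2⟩ := D.surj r (D.ct r - 1) (by omega)
        obtain ⟨z, rfl⟩ := (e.trans t).surjective i
        simp only [Equiv.trans_apply] at hi1 hi2
        have he := (heven r).two_dvd
        rcases z with b | ⟨a, β⟩
        · exact isEmptyElim b
        · have h1 := D.nz_pair e f t ht _ a β rfl
          have h2 := D.nz_B e f t ht a β
          refine ⟨a, ?_, ?_⟩
          · simp only [hQ]
            cases β
            · simp only [Bool.not_false] at h1 h2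
              rw [hi1]; omega
            · simp only [Bool.not_true] at h1 h2
              rw [← h2.1, hi1]; omega
          · cases β
            · exact hi1
            · rw [← hi1, h2.1]; rfl
    have hinj : Set.InjOn (fun a => D.grp (t (e (Sum.inr (a, false)))))
        (Finset.univ.filter fun a => ¬ Q a) := by
      intro a ha a' ha' hg
      simp only [Finset.coe_filter, Finset.mem_univ, true_and] at ha ha'
      change ¬ Q a at ha
      change ¬ Q a' at ha'
      simp only at hg
      simp only [hQ] at ha ha'
      have b1 := D.nz_pair e f t ht _ a false rfl
      have b2 := D.nz_B e f t ht a false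
      have b3 := D.nz_pair e f t ht _ a' false rfl
      have b4 := D.nz_B e f t ht a' false
      simp only [Bool.not_false] at b1 b2 b3 b4
      have b5 := D.rk_lt (t (e (Sum.inr (a, false))))
      have b6 := D.rk_lt (t (e (Sum.inr (a, true))))
      have b7 := D.rk_lt (t (e (Sum.inr (a', false))))
      have b8 := D.rk_lt (t (e (Sum.inr (a', true))))
      rw [← b2.1] at b6
      rw [← b4.1] at b8
      rw [← hg] at b7 b8 ha'
      have b9 := (heven (D.grp (t (e (Sum.inr (a, false)))))).two_dvd
      by_cases h : D.rk (t (e (Sum.inr (a, false)))) = D.rk (t (e (Sum.inr (a', false))))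
      · have := e.injective (t.injective (D.inj _ _ hg h))
        simpa using this
      · have := e.injective (t.injective (D.inj (t (e (Sum.inr (a, false))))
          (t (e (Sum.inr (a', true)))) (by rw [hg, b4.1]) (by omega)))
        simp at this
    have hcard2 : (Finset.univ.filter fun a => ¬ Q a).card =
        ((Finset.range ν).filter (fun r => 1 ≤ D.ct r)).card := by
      rw [← himg, Finset.card_image_of_injOn hinj]
    have hle : ((Finset.range ν).filter (fun r => 1 ≤ D.ct r)).card ≤ ν := by
      simpa using Finset.card_filter_le (Finset.range ν) (fun r => 1 ≤ D.ct r)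
    have hxa : 2 ^ (k - ν) * x.natAbs = 2 ^ (k - ν) *
        2 ^ (ν - ((Finset.range ν).filter (fun r => 1 ≤ D.ct r)).card) := by
      rw [← pow_add]
      have := congrArg Int.natAbs hx
      rw [habs, Int.natAbs_mul, Int.natAbs_pow] at this
      rw [show k - ν + (ν - ((Finset.range ν).filter (fun r => 1 ≤ D.ct r)).card) =
        (Finset.univ.filter Q).card by omega]
      exact this
    have hxa2 := Nat.eq_of_mul_eq_mul_left (by positivity) hxa
    rw [← Int.natAbs_odd, hxa2]
    have hiff : (∀ r < ν, Even (D.ct r) ∧ 1 ≤ D.ct r) ↔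
        ((Finset.range ν).filter (fun r => 1 ≤ D.ct r)).card = ν := by
      have := Finset.card_filter_eq_iff (s := Finset.range ν) (p := fun r => 1 ≤ D.ct r)
      rw [Finset.card_range] at this
      rw [this]
      simp only [Finset.mem_range]
      exact ⟨fun h r hr => (h r hr).2, fun h r hr => ⟨heven r, h r hr⟩⟩
    rw [hiff]
    constructor
    · intro h
      by_contra hne
      have : ν - ((Finset.range ν).filter (fun r => 1 ≤ D.ct r)).card ≠ 0 := by omega
      rw [← Nat.not_even_iff_odd, Nat.even_pow] at h
      exact h ⟨by decide, this⟩
    · intro h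
      rw [h, Nat.sub_self, pow_zero]
      exact odd_one

lemma RD.exists_h (D : RD M (Fin (2 * ν))) (e : Fin (2 * ν) ⊕ Fin k × Bool ≃ M)
    (hc : ∀ i, D.grp i = (D.c i).1 / 2)
    (hgood : ∀ r < ν, Even (D.ct r) ∧ 1 ≤ D.ct r) :
    ∃ t : Equiv.Perm M, hTerm e (D.V' id) D.B' t ≠ 0 := by
  classical
  have hgl : ∀ i, D.grp i < ν := by
    intro i
    have := (D.c i).2
    rw [hc]; omega
  have hm : ∀ i : {i : M // D.rk i % 2 = 0 ∧ D.rk i + 2 < D.ct (D.grp i)},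
      ∃ j, D.grp j = D.grp i ∧ D.rk j = D.rk i + 1 := by
    intro i
    apply D.surj
    have h3 := i.2.2
    omega
  choose mate hm1 hm2 using hm
  have hl : ∀ b : Fin (2 * ν), ∃ i, D.c i = b ∧ D.ct (D.grp i) ≤ D.rk i + 2 := by
    intro b
    have hb := b.2
    obtain ⟨h1, h2⟩ := hgood (b.1 / 2) (by omega)
    have h1 := h1.two_dvd
    obtain ⟨i, hi1, hi2⟩ := D.surj (b.1 / 2) (D.ct (b.1 / 2) - 1) (by omega)
    obtain ⟨j, hj1, hj2⟩ := D.surj (b.1 / 2) (D.ct (b.1 / 2) - 2) (by omega)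
    have h3 := D.par i j (by omega)
    have h4 : D.c i ≠ D.c j := by
      intro h; rw [h3] at h; omega
    have h5 := hc i
    have h6 := hc j
    have h7 : (D.c i).1 ≠ (D.c j).1 := fun h => h4 (Fin.ext h)
    by_cases h8 : (D.c i).1 = b.1
    · exact ⟨i, Fin.ext h8, by rw [hi1]; omega⟩
    · exact ⟨j, Fin.ext (by omega), by rw [hj1]; omega⟩
  choose last hl1 hl2 using hl
  let φ : Fin (2 * ν) ⊕ {i : M // D.rk i % 2 = 0 ∧ D.rk i + 2 < D.ct (D.grp i)} × Bool → M :=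
    fun z => match z with
    | Sum.inl b => last b
    | Sum.inr (i, false) => i.1
    | Sum.inr (i, true) => mate i
  have hlm : ∀ b (i : {i : M // D.rk i % 2 = 0 ∧ D.rk i + 2 < D.ct (D.grp i)}), last b ≠ i.1 := by
    intro b i h
    have h1 := hl2 b
    have h2 := i.2.2
    rw [h] at h1
    omega
  have hlm2 : ∀ b (i : {i : M // D.rk i % 2 = 0 ∧ D.rk i + 2 < D.ct (D.grp i)}), last b ≠ mate i := by
    intro b i h
    have h1 := hl2 b
    have h2 := i.2
    have h3 := hm1 i
    have h4 := hm2 i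
    rw [h, h3] at h1
    have := (hgood _ (hgl i)).1.two_dvd
    omega
  have hmm : ∀ i i' : {i : M // D.rk i % 2 = 0 ∧ D.rk i + 2 < D.ct (D.grp i)}, mate i ≠ i'.1 := by
    intro i i' h
    have h1 := hm2 i
    have h2 := i'.2.1
    have h3 := i.2.1
    rw [h] at h1
    omega
  have hφ : Function.Bijective φ := by
    constructor
    · intro z z' h
      rcases z with b | ⟨i, (_ | _)⟩ <;> rcases z' with b' | ⟨i', (_ | _)⟩ <;> simp only [φ] at h
      · rw [← hl1 b, ← hl1 b', h]
      · exact absurd h (hlm _ _)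
      · exact absurd h (hlm2 _ _)
      · exact absurd h.symm (hlm _ _)
      · rw [Subtype.ext h]
      · exact absurd h.symm (hmm _ _)
      · exact absurd h.symm (hlm2 _ _)
      · exact absurd h (hmm _ _)
      · have h1 := hm2 i
        have h2 := hm2 i'
        have h3 := hm1 i
        have h4 := hm1 i'
        rw [h] at h1 h3
        have : i.1 = i'.1 := D.inj _ _ (by omega) (by omega)
        rw [Subtype.ext this]
    · intro j
      by_cases hlast : D.ct (D.grp j) ≤ D.rk j + 2
      · exact ⟨Sum.inl (D.c j), D.last_unique _ _ (hl1 _) (hl2 _) hlast⟩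
      by_cases hj : D.rk j % 2 = 0
      · exact ⟨Sum.inr (⟨j, hj, by omega⟩, false), rfl⟩
      · have h1 := D.rk_lt j
        obtain ⟨i, hi1, hi2⟩ := D.surj (D.grp j) (D.rk j - 1) (by omega)
        have hi3 : D.rk i % 2 = 0 ∧ D.rk i + 2 < D.ct (D.grp i) := ⟨by omega, by rw [hi1]; omega⟩
        refine ⟨Sum.inr (⟨i, hi3⟩, true), ?_⟩
        have h4 := hm1 ⟨i, hi3⟩
        have h5 := hm2 ⟨i, hi3⟩
        simp only at h4 h5
        exact D.inj _ _ (by simp only [φ]; omega) (by simp only [φ]; omega)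
  obtain ⟨t, θ, ht1, ht2⟩ := perm_of_bij e φ hφ
  refine ⟨t, ?_⟩
  unfold hTerm
  refine mul_ne_zero ?_ ?_
  · rw [Finset.prod_ne_zero_iff]
    intro b _
    rw [ht1]
    simp only [φ, RD.V', id]
    rw [if_pos ⟨hl1 b, hl2 b⟩]
    exact one_ne_zero
  · rw [Finset.prod_ne_zero_iff]
    intro a _
    rw [ht2, ht2]
    simp only [φ]
    have h1 := hm1 (θ a)
    have h2 := hm2 (θ a)
    rw [RD.B', if_pos ⟨h1.symm, Or.inl h2⟩]
    split_ifs <;> simp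

lemma RD.h_parity (D : RD M (Fin (2 * ν))) (e : Fin (2 * ν) ⊕ Fin k × Bool ≃ M)
    (hc : ∀ i, D.grp i = (D.c i).1 / 2) (x : ℤ)
    (hx : 2 ^ k * x = hSum e (D.V id) D.B) :
    Odd x ↔ ∀ r < ν, Even (D.ct r) ∧ 1 ≤ D.ct r := by
  classical
  rcases D.hSum_cases e id with ⟨h0, hz⟩ | ⟨t, ht, habs⟩
  · rw [h0] at hx
    have hx0 : x = 0 := by
      rcases mul_eq_zero.1 hx with h | h
      · exact absurd h (by positivity)
      · exact h
    subst hx0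
    simp only [Int.not_odd_zero, false_iff]
    intro h
    obtain ⟨t, ht⟩ := D.exists_h e hc h
    exact ht (hz t)
  · have hQ : (Finset.univ.filter fun a : Fin k =>
          min (D.rk (t (e (Sum.inr (a, false))))) (D.rk (t (e (Sum.inr (a, true))))) + 2 <
            D.ct (D.grp (t (e (Sum.inr (a, false)))))) = Finset.univ := by
      rw [Finset.filter_eq_self]
      intro a _
      by_contra hcon
      have key : ∀ β, ¬ D.ct (D.grp (t (e (Sum.inr (a, β))))) ≤ D.rk (t (e (Sum.inr (a, β)))) + 2 := by
        intro β hβ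
        have h1 := D.nz_V e id t ht (D.c (t (e (Sum.inr (a, β)))))
        have h2 := D.last_unique _ _ h1.1 h1.2 hβ
        have := e.injective (t.injective h2)
        simp at this
      have k1 := key false
      have k2 := key true
      have k3 := (D.nz_B e id t ht a false).1
      simp only [Bool.not_false] at k3
      rw [← k3] at k2
      omega
    rw [hQ, Finset.card_univ, Fintype.card_fin] at habs
    have h1 := congrArg Int.natAbs hx
    rw [habs, Int.natAbs_mul, Int.natAbs_pow] at h1
    have h2 : x.natAbs = 1 := by
      apply Nat.eq_of_mul_eq_mul_left (show 0 < 2 ^ k by positivity)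
      rw [mul_one]; exact h1
    rw [← Int.natAbs_odd, h2]
    simp only [odd_one, true_iff]
    intro r hr
    obtain ⟨p1, p2⟩ := D.nz_V e id t ht ⟨2 * r, by omega⟩
    obtain ⟨q1, q2⟩ := D.nz_V e id t ht ⟨2 * r + 1, by omega⟩
    have p3 := hc (t (e (Sum.inl ⟨2 * r, by omega⟩)))
    have q3 := hc (t (e (Sum.inl ⟨2 * r + 1, by omega⟩)))
    rw [p1] at p3
    rw [q1] at q3
    simp only [id] at p3 q3
    have p4 : D.grp (t (e (Sum.inl ⟨2 * r, by omega⟩))) = r := by rw [p3]; omega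
    have q4 : D.grp (t (e (Sum.inl ⟨2 * r + 1, by omega⟩))) = r := by rw [q3]; omega
    have p5 := D.rk_lt (t (e (Sum.inl ⟨2 * r, by omega⟩)))
    have q5 := D.rk_lt (t (e (Sum.inl ⟨2 * r + 1, by omega⟩)))
    rw [p4] at p2 p5
    rw [q4] at q2 q5
    have hne : D.rk (t (e (Sum.inl ⟨2 * r, by omega⟩))) ≠
        D.rk (t (e (Sum.inl ⟨2 * r + 1, by omega⟩))) := by
      intro h
      have := e.injective (t.injective (D.inj _ _ (p4.trans q4.symm) h))
      simp at this
    have hb : ∃ b, D.grp (t (e (Sum.inl b))) = r ∧ D.rk (t (e (Sum.inl b))) + 2 = D.ct r := by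
      by_cases h : D.rk (t (e (Sum.inl ⟨2 * r, by omega⟩))) + 2 = D.ct r
      · exact ⟨_, p4, h⟩
      · exact ⟨_, q4, by omega⟩
    obtain ⟨b, hb1, hb2⟩ := hb
    refine ⟨?_, by omega⟩
    by_contra hodd
    rw [Nat.not_even_iff] at hodd
    obtain ⟨i, hi1, hi2⟩ := D.surj r (D.ct r - 3) (by omega)
    obtain ⟨z, rfl⟩ := (e.trans t).surjective i
    simp only [Equiv.trans_apply] at hi1 hi2
    rcases z with b' | ⟨a, β⟩
    · have := (D.nz_V e id t ht b').2
      rw [hi1] at this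
      omega
    · have := D.nz_mate e id t ht a β (t (e (Sum.inl b))) (hb1.trans hi1.symm) (by omega)
        (by intro h; have := e.injective (t.injective h); simp at this)
      have := e.injective (t.injective this)
      simp at this

end Part3

section Part4

variable {m n : ℕ}

def rkc (c : Fin m → Fin n) (i : Fin m) : ℕ :=
  (Finset.univ.filter fun l : Fin m => l < i ∧ (c l).1 / 2 = (c i).1 / 2).card

def Bc (c : Fin m → Fin n) (i j : Fin m) : ℤ :=
  if (c i).1 / 2 = (c j).1 / 2 ∧ c i ≠ c j then (if i < j then 1 else -1) else 0

def Vc {ι : Type*} (c : Fin m → Fin n) (f : ι → Fin n) (b : ι) (i : Fin m) : ℤ :=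
  if c i = f b then 1 else 0

lemma rkc_mono (c : Fin m → Fin n) (i j : Fin m) (h : (c i).1 / 2 = (c j).1 / 2) (hij : i < j) :
    rkc c i < rkc c j := by
  apply Finset.card_lt_card
  rw [Finset.ssubset_iff_of_subset]
  · exact ⟨i, by simp [hij, h], by simp⟩
  · intro l
    simp only [Finset.mem_filter, Finset.mem_univ, true_and]
    rintro ⟨h1, h2⟩
    exact ⟨h1.trans hij, h2.trans h⟩

lemma rkc_lt_iff (c : Fin m → Fin n) (i j : Fin m) (h : (c i).1 / 2 = (c j).1 / 2) :
    rkc c i < rkc c j ↔ i < j := by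
  refine ⟨fun h1 => ?_, rkc_mono c i j h⟩
  rcases lt_trichotomy i j with h2 | h2 | h2
  · exact h2
  · subst h2; omega
  · have := rkc_mono c j i h.symm h2
    omega

lemma rkc_lt (c : Fin m → Fin n) (i : Fin m) : rkc c i < cnt c ((c i).1 / 2) := by
  apply Finset.card_lt_card
  rw [Finset.ssubset_iff_of_subset]
  · exact ⟨i, by simp, by simp⟩
  · intro l
    simp only [Finset.mem_filter, Finset.mem_univ, true_and]
    exact fun h => h.2

lemma rkc_surj (c : Fin m → Fin n) (r s : ℕ) (h : s < cnt c r) :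
    ∃ i, (c i).1 / 2 = r ∧ rkc c i = s := by
  have hinj : Set.InjOn (rkc c) (Finset.univ.filter fun i : Fin m => (c i).1 / 2 = r) := by
    intro i hi j hj hij
    have hi : (c i).1 / 2 = r := by simpa using hi
    have hj : (c j).1 / 2 = r := by simpa using hj
    rcases lt_trichotomy i j with h2 | h2 | h2
    · have := rkc_mono c i j (hi.trans hj.symm) h2
      omega
    · exact h2
    · have := rkc_mono c j i (hj.trans hi.symm) h2
      omega
  have himg : (Finset.univ.filter fun i : Fin m => (c i).1 / 2 = r).image (rkc c) =
      Finset.range (cnt c r) := by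
    apply Finset.eq_of_subset_of_card_le
    · intro x
      simp only [Finset.mem_image, Finset.mem_filter, Finset.mem_univ, true_and, Finset.mem_range]
      rintro ⟨i, rfl, rfl⟩
      exact rkc_lt c i
    · rw [Finset.card_image_of_injOn hinj, Finset.card_range]
      exact le_rfl
  have : s ∈ (Finset.univ.filter fun i : Fin m => (c i).1 / 2 = r).image (rkc c) := by
    rw [himg]; simpa using h
  simpa using this

lemma rkc_par {ν : ℕ} (c : Fin m → Fin (2 * ν)) (h : ∀ r < ν, Alt c r) (s : ℕ) :
    ∀ i j : Fin m, (c i).1 / 2 = (c j).1 / 2 → rkc c j = rkc c i + s →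
      ((c i).1 + (c j).1 + s) % 2 = 0 := by
  induction s with
  | zero =>
    intro i j hij hr
    have : i = j := by
      rcases lt_trichotomy i j with h2 | h2 | h2
      · have := rkc_mono c i j hij h2
        omega
      · exact h2
      · have := rkc_mono c j i hij.symm h2
        omega
    subst this
    omega
  | succ s ih =>
    intro i j hij hr
    have h1 := rkc_lt c j
    obtain ⟨l, hl1, hl2⟩ := rkc_surj c ((c j).1 / 2) (rkc c i + s) (by omega)
    have h2 := ih i l (hij.trans hl1.symm) hl2
    have hlt : l < j := (rkc_lt_iff c l j hl1).1 (by omega)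
    have hcj := (c j).2
    have h3 := h ((c j).1 / 2) (by omega) l j hlt hl1 rfl (by
      intro p hp1 hp2 hp3
      have q1 := rkc_mono c l p (hl1.trans hp3.symm) hp1
      have q2 := rkc_mono c p j hp3 hp2
      omega)
    have h4 : (c l).1 ≠ (c j).1 := fun h => h3 (Fin.ext h)
    omega

def mkRD {ν : ℕ} (c : Fin m → Fin (2 * ν)) (h : ∀ r < ν, Alt c r) :
    RD (Fin m) (Fin (2 * ν)) where
  c := c
  grp := fun i => (c i).1 / 2
  rk := rkc c
  ct := cnt c
  rk_lt := rkc_lt c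
  lt_iff := rkc_lt_iff c
  surj := rkc_surj c
  grp_c := fun i j hij => by rw [hij]
  par := by
    intro i j hij
    have key : ((c i).1 + (c j).1 + rkc c i + rkc c j) % 2 = 0 := by
      rcases le_total (rkc c i) (rkc c j) with h1 | h1
      · have := rkc_par c h (rkc c j - rkc c i) i j hij (by omega)
        omega
      · have := rkc_par c h (rkc c i - rkc c j) j i hij.symm (by omega)
        omega
    rw [Fin.ext_iff]
    omega

lemma mkRD_B {ν : ℕ} (c : Fin m → Fin (2 * ν)) (h : ∀ r < ν, Alt c r) :
    (mkRD c h).B = Bc c := by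
  funext i j
  unfold RD.B Bc
  by_cases hij : (c i).1 / 2 = (c j).1 / 2
  · have h1 := (mkRD c h).par i j hij
    have h2 := (mkRD c h).lt_iff i j hij
    simp only [h2]
    have h3 : ((mkRD c h).grp i = (mkRD c h).grp j ∧
        ((mkRD c h).rk i + (mkRD c h).rk j) % 2 = 1) ↔ ((c i).1 / 2 = (c j).1 / 2 ∧ c i ≠ c j) := by
      refine and_congr Iff.rfl ?_
      change (c i = c j ↔ _) at h1
      rw [Ne, h1]
      omega
    simp only [h3]
  · rw [if_neg (fun h => hij h.1), if_neg (fun h => hij h.1)]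

lemma mkRD_V {ι : Type*} {ν : ℕ} (c : Fin m → Fin (2 * ν)) (h : ∀ r < ν, Alt c r)
    (f : ι → Fin (2 * ν)) : (mkRD c h).V f = Vc c f := rfl

lemma Bc_skew (c : Fin m → Fin n) (i j : Fin m) : Bc c i j = - Bc c j i := by
  unfold Bc
  rcases lt_trichotomy i j with h | h | h
  · by_cases h2 : (c i).1 / 2 = (c j).1 / 2 ∧ c i ≠ c j
    · rw [if_pos h2, if_pos h, if_pos ⟨h2.1.symm, h2.2.symm⟩, if_neg h.not_gt]; norm_num
    · rw [if_neg h2, if_neg (fun h3 => h2 ⟨h3.1.symm, h3.2.symm⟩)]; norm_num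
  · subst h; simp
  · by_cases h2 : (c i).1 / 2 = (c j).1 / 2 ∧ c i ≠ c j
    · rw [if_pos h2, if_neg h.not_gt, if_pos ⟨h2.1.symm, h2.2.symm⟩, if_pos h]
    · rw [if_neg h2, if_neg (fun h3 => h2 ⟨h3.1.symm, h3.2.symm⟩)]; norm_num

lemma transv_sum (i j p : Fin m) (F : Fin m → ℤ) :
    ∑ l, (Matrix.transvection i j (-1 : ℤ)) p l * F l = F p - if p = i then F j else 0 := by
  have : ∀ l, (Matrix.transvection i j (-1 : ℤ)) p l * F l =
      (if p = l then F l else 0) - (if j = l then (if p = i then F l else 0) else 0) := by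
    intro l
    simp only [Matrix.transvection, Matrix.add_apply, Matrix.one_apply, Matrix.single_apply]
    rw [add_mul, sub_eq_add_neg]
    congr 1
    · split_ifs <;> simp
    · grind
  simp only [this, Finset.sum_sub_distrib, Finset.sum_ite_eq, Finset.mem_univ, if_true]

lemma hSum_nonalt {ι : Type*} [Fintype ι] [DecidableEq ι] {k : ℕ} (c : Fin m → Fin n)
    (e : ι ⊕ Fin k × Bool ≃ Fin m) (f : ι → Fin n) (r : ℕ) (h : ¬ Alt c r) :
    hSum e (Vc c f) (Bc c) = 0 := by
  unfold Alt at h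
  push Not at h
  obtain ⟨i, j, hij, hi, hj, hl, hc⟩ := h
  rw [hSum_congruence e _ _ (Bc_skew c) (Matrix.transvection i j (-1))
    (Matrix.det_transvection_of_ne i j hij.ne _)]
  have hBB : ∀ l, Bc c l i = Bc c l j := by
    intro l
    unfold Bc
    rw [hc]
    by_cases h2 : (c l).1 / 2 = (c j).1 / 2 ∧ c l ≠ c j
    · rw [if_pos h2, if_pos h2]
      have h3 : l < i ↔ l < j := by
        refine ⟨fun h => h.trans hij, fun h => ?_⟩
        rcases lt_trichotomy l i with h4 | h4 | h4
        · exact h4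
        · subst h4; exact absurd hc h2.2
        · exact absurd (h2.1.trans hj) (hl l h4 h)
      simp only [h3]
    · rw [if_neg h2, if_neg h2]
  have hBB2 : ∀ l, Bc c i l = Bc c j l := by
    intro l
    rw [Bc_skew c i, Bc_skew c j, hBB]
  have hV : ∀ b, cV (Matrix.transvection i j (-1)) (Vc c f) b i = 0 := by
    intro b
    simp only [cV, transv_sum, if_true, Vc, hc, sub_self]
  have hB1 : ∀ p, cB (Matrix.transvection i j (-1)) (Bc c) i p = 0 := by
    intro p
    simp only [cB, transv_sum, if_true, hBB2, sub_self]
  have hB2 : ∀ p, cB (Matrix.transvection i j (-1)) (Bc c) p i = 0 := by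
    intro p
    simp only [cB, transv_sum, if_true, hBB, sub_self]
    simp
  apply hSum_zero
  intro t
  obtain ⟨z, hz⟩ := (e.trans t).surjective i
  simp only [Equiv.trans_apply] at hz
  unfold hTerm
  rcases z with b | ⟨a, (_ | _)⟩
  · rw [Finset.prod_eq_zero (Finset.mem_univ b) (by rw [hz, hV]), zero_mul]
  · rw [Finset.prod_eq_zero (s := Finset.univ (α := Fin k)) (Finset.mem_univ a)
      (by rw [hz, hB1]), mul_zero]
  · rw [Finset.prod_eq_zero (s := Finset.univ (α := Fin k)) (Finset.mem_univ a)
      (by rw [hz, hB2]), mul_zero]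

lemma g_odd_iff {ι : Type*} [Fintype ι] [DecidableEq ι] [IsEmpty ι] {k ν : ℕ}
    (c : Fin m → Fin (2 * ν)) (e : ι ⊕ Fin k × Bool ≃ Fin m) (f : ι → Fin (2 * ν))
    (hk : ν ≤ k) (x : ℤ) (hx : 2 ^ (k - ν) * x = hSum e (Vc c f) (Bc c)) :
    Odd x ↔ ∀ r < ν, Even (cnt c r) ∧ 1 ≤ cnt c r ∧ Alt c r := by
  by_cases h : ∀ r < ν, Alt c r
  · rw [← mkRD_B c h, ← mkRD_V c h] at hx
    rw [(mkRD c h).g_parity e f (fun i => rfl) hk x hx]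
    exact forall₂_congr fun r hr => ⟨fun h1 => ⟨h1.1, h1.2, h r hr⟩, fun h1 => ⟨h1.1, h1.2.1⟩⟩
  · have h' := h
    push Not at h
    obtain ⟨r, hr, h⟩ := h
    rw [hSum_nonalt c e f r h] at hx
    have hx0 : x = 0 := by
      rcases mul_eq_zero.1 hx with h | h
      · exact absurd h (by positivity)
      · exact h
    subst hx0
    simp only [Int.not_odd_zero, false_iff]
    exact fun h1 => h' fun r hr => (h1 r hr).2.2

lemma h_odd_iff {k ν : ℕ}
    (c : Fin m → Fin (2 * ν)) (e : Fin (2 * ν) ⊕ Fin k × Bool ≃ Fin m)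
    (x : ℤ) (hx : 2 ^ k * x = hSum e (Vc c id) (Bc c)) :
    Odd x ↔ ∀ r < ν, Even (cnt c r) ∧ 1 ≤ cnt c r ∧ Alt c r := by
  by_cases h : ∀ r < ν, Alt c r
  · rw [← mkRD_B c h, ← mkRD_V c h] at hx
    rw [(mkRD c h).h_parity e (fun i => rfl) x hx]
    exact forall₂_congr fun r hr => ⟨fun h1 => ⟨h1.1, h1.2, h r hr⟩, fun h1 => ⟨h1.1, h1.2.1⟩⟩
  · have h' := h
    push Not at h
    obtain ⟨r, hr, h⟩ := h
    rw [hSum_nonalt c e id r h] at hx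
    have hx0 : x = 0 := by
      rcases mul_eq_zero.1 hx with h | h
      · exact absurd h (by positivity)
      · exact h
    subst hx0
    simp only [Int.not_odd_zero, false_iff]
    exact fun h1 => h' fun r hr => (h1 r hr).2.2

end Part4

section Part5

def pb (k : ℕ) : Fin k × Bool ≃ Fin (2 * k) where
  toFun x := ⟨2 * x.1.1 + x.2.toNat, by have := x.1.2; have := x.2.toNat_lt; omega⟩
  invFun y := (⟨y.1 / 2, by have := y.2; omega⟩, decide (y.1 % 2 = 1))
  left_inv := by
    rintro ⟨a, (_ | _)⟩
    · simp
    · simp only [Bool.toNat_true]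
      refine Prod.ext (Fin.ext ?_) ?_
      · simp only; omega
      · simp only [decide_eq_true_eq]; omega
  right_inv := by
    intro y
    apply Fin.ext
    simp only
    by_cases h : y.1 % 2 = 1
    · simp only [h, decide_true, Bool.toNat_true]; omega
    · simp only [h, decide_false, Bool.toNat_false]; omega

def ee0 {m n k : ℕ} (h : m = n + 2 * k) : Fin n ⊕ Fin (2 * k) ≃ Fin m :=
  finSumFinEquiv.trans (finCongr h.symm)

def ee1 (k : ℕ) : Empty ⊕ Fin k × Bool ≃ Fin (2 * k) :=
  (Equiv.emptySum Empty _).trans (pb k)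

def ee2 {m n k : ℕ} (h : m = n + 2 * k) : Fin n ⊕ Fin k × Bool ≃ Fin m :=
  (Equiv.sumCongr (Equiv.refl _) (pb k)).trans (ee0 h)

/-- The term over a commutative ring. -/
def gT {R ι κ M : Type*} [CommRing R] [Fintype ι] [Fintype κ] [Fintype M] [DecidableEq M]
    (e : ι ⊕ κ × Bool ≃ M) (V : ι → M → R) (B : M → M → R) (t : Equiv.Perm M) : R :=
  (Equiv.Perm.sign t : ℤ) • ((∏ b, V b (t (e (Sum.inl b)))) *
    ∏ a, B (t (e (Sum.inr (a, false)))) (t (e (Sum.inr (a, true)))))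

variable {R : Type*} [CommRing R]

lemma mem_pfPerms {k : ℕ} (τ : Equiv.Perm (Fin (2 * k))) : τ ∈ pfPerms k ↔
    (∀ a, τ (pb k (a, false)) < τ (pb k (a, true))) ∧
    ∀ a b : Fin k, a < b → τ (pb k (a, false)) < τ (pb k (b, false)) := by
  unfold pfPerms
  rw [Finset.mem_filter]
  simp only [Finset.mem_univ, true_and]
  rfl

lemma pfaffian_eq {k : ℕ} (A : Matrix (Fin (2 * k)) (Fin (2 * k)) R) :
    pfaffian A = ∑ τ ∈ pfPerms k, (Equiv.Perm.sign τ : ℤ) •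
      ∏ a, A (τ (pb k (a, false))) (τ (pb k (a, true))) := rfl

open Classical in
lemma pf_expand {k : ℕ} (A : Matrix (Fin (2 * k)) (Fin (2 * k)) R) (V : Empty → Fin (2 * k) → R) :
    pfaffian A = ∑ t ∈ Finset.univ.filter (fun t => InT (ee1 k) t), gT (ee1 k) V A t := by
  rw [pfaffian_eq]
  apply Finset.sum_congr
  · ext τ
    rw [mem_pfPerms, Finset.mem_filter]
    simp only [Finset.mem_univ, true_and]
    rfl
  · intro τ _
    unfold gT
    rw [Finset.univ_eq_empty (α := Empty), Finset.prod_empty, one_mul]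
    rfl

def Shuf {m n k : ℕ} (h : m = n + 2 * k) (σ : Equiv.Perm (Fin m)) : Prop :=
  StrictMono (fun b => σ (ee0 h (Sum.inl b))) ∧ StrictMono (fun x => σ (ee0 h (Sum.inr x)))

/-- combine a shuffle with permutations of the two blocks -/
def comb {m n k : ℕ} (h : m = n + 2 * k) (σ : Equiv.Perm (Fin m)) (ρ : Equiv.Perm (Fin n))
    (τ : Equiv.Perm (Fin (2 * k))) : Equiv.Perm (Fin m) :=
  σ * (ee0 h).permCongr (Equiv.Perm.sumCongr ρ τ)

lemma comb_inl {m n k : ℕ} (h : m = n + 2 * k) (σ : Equiv.Perm (Fin m)) (ρ : Equiv.Perm (Fin n))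
    (τ : Equiv.Perm (Fin (2 * k))) (b : Fin n) :
    comb h σ ρ τ (ee0 h (Sum.inl b)) = σ (ee0 h (Sum.inl (ρ b))) := by
  simp [comb]

lemma comb_inr {m n k : ℕ} (h : m = n + 2 * k) (σ : Equiv.Perm (Fin m)) (ρ : Equiv.Perm (Fin n))
    (τ : Equiv.Perm (Fin (2 * k))) (x : Fin (2 * k)) :
    comb h σ ρ τ (ee0 h (Sum.inr x)) = σ (ee0 h (Sum.inr (τ x))) := by
  simp [comb]

lemma comb_sign {m n k : ℕ} (h : m = n + 2 * k) (σ : Equiv.Perm (Fin m)) (ρ : Equiv.Perm (Fin n))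
    (τ : Equiv.Perm (Fin (2 * k))) :
    Equiv.Perm.sign (comb h σ ρ τ) =
      Equiv.Perm.sign σ * (Equiv.Perm.sign ρ * Equiv.Perm.sign τ) := by
  rw [comb, Equiv.Perm.sign_mul, Equiv.Perm.sign_permCongr, Equiv.Perm.sign_sumCongr]

lemma comb_InT {m n k : ℕ} (h : m = n + 2 * k) (σ : Equiv.Perm (Fin m)) (hσ : Shuf h σ)
    (ρ : Equiv.Perm (Fin n)) (τ : Equiv.Perm (Fin (2 * k))) :
    InT (ee2 h) (comb h σ ρ τ) ↔ τ ∈ pfPerms k := by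
  have key : ∀ a β, comb h σ ρ τ (ee2 h (Sum.inr (a, β))) = σ (ee0 h (Sum.inr (τ (pb k (a, β))))) :=
    fun a β => comb_inr h σ ρ τ (pb k (a, β))
  rw [mem_pfPerms]
  unfold InT
  refine and_congr ?_ ?_
  · refine forall_congr' fun a => ?_
    rw [key, key]
    exact hσ.2.lt_iff_lt
  · refine forall_congr' fun a => forall_congr' fun b => ?_
    simp only [key]
    exact imp_congr_right fun _ => hσ.2.lt_iff_lt

lemma comb_inj {m n k : ℕ} (h : m = n + 2 * k) (σ σ' : Equiv.Perm (Fin m)) (hσ : Shuf h σ)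
    (hσ' : Shuf h σ') (ρ ρ' : Equiv.Perm (Fin n)) (τ τ' : Equiv.Perm (Fin (2 * k)))
    (heq : comb h σ ρ τ = comb h σ' ρ' τ') : σ = σ' ∧ ρ = ρ' ∧ τ = τ' := by
  have h1 : ∀ b, σ (ee0 h (Sum.inl (ρ b))) = σ' (ee0 h (Sum.inl (ρ' b))) := by
    intro b; rw [← comb_inl h σ ρ τ, heq, comb_inl]
  have h2 : ∀ b, σ (ee0 h (Sum.inr (τ b))) = σ' (ee0 h (Sum.inr (τ' b))) := by
    intro b; rw [← comb_inr h σ ρ τ, heq, comb_inr]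
  have r1 : (fun b => σ (ee0 h (Sum.inl b))) = fun b => σ' (ee0 h (Sum.inl b)) := by
    apply (hσ.1.range_inj hσ'.1).1
    rw [← ρ.surjective.range_comp, ← ρ'.surjective.range_comp (fun b => σ' (ee0 h (Sum.inl b)))]
    congr 1
    funext b
    exact h1 b
  have r2 : (fun b => σ (ee0 h (Sum.inr b))) = fun b => σ' (ee0 h (Sum.inr b)) := by
    apply (hσ.2.range_inj hσ'.2).1
    rw [← τ.surjective.range_comp, ← τ'.surjective.range_comp (fun b => σ' (ee0 h (Sum.inr b)))]
    congr 1
    funext b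
    exact h2 b
  have hs : σ = σ' := by
    ext1 i
    obtain ⟨z, rfl⟩ := (ee0 h).surjective i
    rcases z with b | b
    · exact congrFun r1 b
    · exact congrFun r2 b
  subst hs
  refine ⟨rfl, ?_, ?_⟩
  · ext1 b
    have := (ee0 h).injective (σ.injective (h1 b))
    simpa using this
  · ext1 b
    have := (ee0 h).injective (σ.injective (h2 b))
    simpa using this

lemma comb_surj {m n k : ℕ} (h : m = n + 2 * k) (t : Equiv.Perm (Fin m)) :
    ∃ σ ρ τ, Shuf h σ ∧ comb h σ ρ τ = t := by
  classical
  set S : Finset (Fin m) := Finset.univ.image (fun b : Fin n => t (ee0 h (Sum.inl b))) with hS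
  have hc1 : S.card = n := by
    rw [hS, Finset.card_image_of_injective, Finset.card_univ, Fintype.card_fin]
    intro a b hab
    simpa using (ee0 h).injective (t.injective hab)
  have hc2 : Sᶜ.card = 2 * k := by
    rw [Finset.card_compl, Fintype.card_fin, hc1]; omega
  let σ : Equiv.Perm (Fin m) := (ee0 h).symm.trans (finSumEquivOfFinset hc1 hc2)
  have s1 : ∀ b, σ (ee0 h (Sum.inl b)) = S.orderEmbOfFin hc1 b := by
    intro b; simp [σ]
  have s2 : ∀ b, σ (ee0 h (Sum.inr b)) = Sᶜ.orderEmbOfFin hc2 b := by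
    intro b; simp [σ]
  have hσ : Shuf h σ := by
    constructor
    · simp only [s1]; exact (S.orderEmbOfFin hc1).strictMono
    · simp only [s2]; exact (Sᶜ.orderEmbOfFin hc2).strictMono
  let u : Equiv.Perm (Fin n ⊕ Fin (2 * k)) := (ee0 h).trans ((t.trans σ.symm).trans (ee0 h).symm)
  have hu : ∀ z, σ (ee0 h (u z)) = t (ee0 h z) := by
    intro z; simp [u]
  have hmaps : Set.MapsTo u (Set.range Sum.inl) (Set.range Sum.inl) := by
    rintro _ ⟨b, rfl⟩
    have hb : t (ee0 h (Sum.inl b)) ∈ S := by rw [hS]; exact Finset.mem_image_of_mem _ (Finset.mem_univ b)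
    have hb' : t (ee0 h (Sum.inl b)) ∈ Set.range (S.orderEmbOfFin hc1) := by
      rw [Finset.range_orderEmbOfFin]; exact hb
    obtain ⟨x, hx⟩ := hb'
    rw [← s1, ← hu] at hx
    exact ⟨x, (ee0 h).injective (σ.injective hx)⟩
  obtain ⟨⟨ρ, τ⟩, hρτ⟩ := Equiv.Perm.mem_sumCongrHom_range_of_perm_mapsTo_inl hmaps
  have hρτ' : Equiv.Perm.sumCongr ρ τ = u := hρτ
  refine ⟨σ, ρ, τ, hσ, ?_⟩
  ext1 i
  obtain ⟨z, rfl⟩ := (ee0 h).surjective i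
  rw [← hu, ← hρτ']
  simp [comb]

open Classical in
lemma shuffle_expand {m n k : ℕ} (h : m = n + 2 * k) (V : Fin n → Fin m → R)
    (B : Fin m → Fin m → R) :
    ∑ σ ∈ Finset.univ.filter (fun σ => Shuf h σ), (Equiv.Perm.sign σ : ℤ) •
      (Matrix.det (Matrix.of fun a b : Fin n => V a (σ (ee0 h (Sum.inl b)))) *
        pfaffian (μ := k) (fun a b => B (σ (ee0 h (Sum.inr a))) (σ (ee0 h (Sum.inr b))))) =
    ∑ t ∈ Finset.univ.filter (fun t => InT (ee2 h) t), gT (ee2 h) V B t := by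
  have expand : ∀ σ : Equiv.Perm (Fin m), (Equiv.Perm.sign σ : ℤ) •
      (Matrix.det (Matrix.of fun a b : Fin n => V a (σ (ee0 h (Sum.inl b)))) *
        pfaffian (μ := k) (fun a b => B (σ (ee0 h (Sum.inr a))) (σ (ee0 h (Sum.inr b))))) =
      ∑ p ∈ (Finset.univ : Finset (Equiv.Perm (Fin n))) ×ˢ pfPerms k,
        gT (ee2 h) V B (comb h σ p.1 p.2) := by
    intro σ
    have hdet : Matrix.det (Matrix.of fun a b : Fin n => V a (σ (ee0 h (Sum.inl b)))) =
        ∑ ρ : Equiv.Perm (Fin n), (Equiv.Perm.sign ρ : ℤ) •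
          ∏ b, V b (σ (ee0 h (Sum.inl (ρ b)))) := by
      rw [← Matrix.det_transpose, Matrix.det_apply]
      rfl
    have hpf : pfaffian (μ := k) (fun a b => B (σ (ee0 h (Sum.inr a))) (σ (ee0 h (Sum.inr b)))) =
        ∑ τ ∈ pfPerms k, (Equiv.Perm.sign τ : ℤ) • ∏ a, B (σ (ee0 h (Sum.inr (τ (pb k (a, false))))))
          (σ (ee0 h (Sum.inr (τ (pb k (a, true)))))) := pfaffian_eq _
    rw [hdet, hpf, Finset.sum_mul_sum, Finset.smul_sum, Finset.sum_product]
    refine Finset.sum_congr rfl fun ρ _ => ?_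
    rw [Finset.smul_sum]
    refine Finset.sum_congr rfl fun τ _ => ?_
    unfold gT
    rw [comb_sign]
    have k1 : ∀ b, comb h σ ρ τ (ee2 h (Sum.inl b)) = σ (ee0 h (Sum.inl (ρ b))) :=
      fun b => comb_inl h σ ρ τ b
    have k2 : ∀ a β, comb h σ ρ τ (ee2 h (Sum.inr (a, β))) =
        σ (ee0 h (Sum.inr (τ (pb k (a, β))))) := fun a β => comb_inr h σ ρ τ (pb k (a, β))
    simp only [k1, k2, zsmul_eq_mul,
      Units.val_mul, Int.cast_mul]
    ring
  rw [Finset.sum_congr rfl fun σ _ => expand σ, ← Finset.sum_product']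
  refine Finset.sum_bij (fun p _ => comb h p.1 p.2.1 p.2.2) ?_ ?_ ?_ ?_
  · rintro ⟨σ, ρ, τ⟩ hp
    simp only [Finset.mem_product, Finset.mem_filter, Finset.mem_univ, true_and] at hp ⊢
    exact (comb_InT h σ hp.1 ρ τ).2 hp.2
  · rintro ⟨σ, ρ, τ⟩ hp ⟨σ', ρ', τ'⟩ hp' heq
    simp only [Finset.mem_product, Finset.mem_filter, Finset.mem_univ, true_and] at hp hp'
    obtain ⟨rfl, rfl, rfl⟩ := comb_inj h σ σ' hp.1 hp'.1 ρ ρ' τ τ' heq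
    rfl
  · intro t ht
    simp only [Finset.mem_filter, Finset.mem_univ, true_and] at ht
    obtain ⟨σ, ρ, τ, hσ, rfl⟩ := comb_surj h t
    refine ⟨⟨σ, ρ, τ⟩, ?_, rfl⟩
    simp only [Finset.mem_product, Finset.mem_filter, Finset.mem_univ, true_and]
    exact ⟨hσ, (comb_InT h σ hσ ρ τ).1 ht⟩
  · intro p _
    rfl

end Part5

section Part6

open MvPolynomial

noncomputable def BB (n m : ℕ) (i j : Fin m) : MvPolynomial (Fin m × Fin n) ℤ :=
  if i < j then Bpoly n m i j else if j < i then -(Bpoly n m j i) else 0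

open Classical in
lemma DPfSum_expand {m n k : ℕ} (h : m = n + 2 * k) (hnm : n ≤ m) :
    DPfSum n m hnm = ∑ t ∈ Finset.univ.filter (fun t => InT (ee2 h) t),
      gT (ee2 h) (fun b i => (X (i, b) : MvPolynomial (Fin m × Fin n) ℤ)) (BB n m) t := by
  have hk : k = (m - n) / 2 := by omega
  subst hk
  rw [← shuffle_expand h]
  unfold DPfSum
  apply Finset.sum_congr
  · ext σ
    rw [Finset.mem_filter, Finset.mem_filter]
    refine and_congr Iff.rfl ?_
    constructor
    · rintro ⟨h1, h2⟩
      refine ⟨fun a b hab => h1 _ _ hab b.2, fun a b hab => h2 _ _ ?_ ?_⟩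
      · rw [Fin.lt_def] at hab ⊢
        change n + a.1 < n + b.1
        omega
      · change n ≤ n + a.1
        omega
    · rintro ⟨h1, h2⟩
      refine ⟨fun i j hij hj => ?_, fun i j hij hi => ?_⟩
      · rw [Fin.lt_def] at hij
        exact h1 (a := ⟨i.1, by omega⟩) (b := ⟨j.1, hj⟩) hij
      · rw [Fin.lt_def] at hij
        have hj2 := j.2
        have hi2 := i.2
        have := h2 (a := ⟨i.1 - n, by omega⟩) (b := ⟨j.1 - n, by omega⟩)
          (by rw [Fin.lt_def]; simp only; omega)
        have e1 : ee0 h (Sum.inr ⟨i.1 - n, by omega⟩) = i := by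
          apply Fin.ext
          change n + (i.1 - n) = i.1
          omega
        have e2 : ee0 h (Sum.inr ⟨j.1 - n, by omega⟩) = j := by
          apply Fin.ext
          change n + (j.1 - n) = j.1
          omega
        simpa only [e1, e2] using this
  · intro σ hσ
    rw [Finset.mem_filter] at hσ
    have hs := hσ.2.2
    congr 2
    congr 1
    funext a b
    have ho : ∀ a b : Fin (2 * ((m - n) / 2)),
        σ (ee0 h (Sum.inr a)) < σ (ee0 h (Sum.inr b)) ↔ a < b := by
      intro a b
      exact hs.lt_iff_lt
    simp only [BB, ho]
    rfl

/-- the evaluation point attached to a letter assignment -/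
def ptc {m n : ℕ} (c : Fin m → Fin n) (p : Fin m × Fin n) : ℤ := if c p.1 = p.2 then 1 else 0

lemma eval_Bpoly {m ν : ℕ} (c : Fin m → Fin (2 * ν)) (i j : Fin m) :
    eval (ptc c) (Bpoly (2 * ν) m i j) =
      if (c i).1 / 2 = (c j).1 / 2 ∧ c i ≠ c j then 1 else 0 := by
  unfold Bpoly
  rw [dif_neg (by omega), add_zero, map_sum]
  simp only [map_add, map_mul, eval_X, ptc, Fin.ext_iff, Ne]
  have hi := (c i).2
  have hj := (c j).2
  split_ifs with h
  · rw [Finset.sum_eq_single (⟨(c i).1 / 2, by omega⟩ : Fin (2 * ν / 2))]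
    · simp only
      by_cases h2 : (c i).1 % 2 = 0
      · rw [if_pos (by omega), if_pos (by omega), if_neg (by omega)]; norm_num
      · rw [if_neg (by omega), if_neg (by omega), if_pos (by omega), if_pos (by omega)]; norm_num
    · intro r _ hr
      have hr' : r.1 ≠ (c i).1 / 2 := fun h => hr (Fin.ext h)
      rw [if_neg (by omega), if_neg (c := (c i).1 = 2 * r.1 + 1) (by omega)]; norm_num
    · intro h; exact absurd (Finset.mem_univ _) h
  · apply Finset.sum_eq_zero
    intro r _
    have : ¬ ((c i).1 = 2 * r.1 ∧ (c j).1 = 2 * r.1 + 1) := by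
      rintro ⟨h1, h2⟩; exact h ⟨by omega, by omega⟩
    have : ¬ ((c i).1 = 2 * r.1 + 1 ∧ (c j).1 = 2 * r.1) := by
      rintro ⟨h1, h2⟩; exact h ⟨by omega, by omega⟩
    split_ifs <;> first | rfl | (exfalso; omega)

lemma eval_BB {m ν : ℕ} (c : Fin m → Fin (2 * ν)) (i j : Fin m) :
    eval (ptc c) (BB (2 * ν) m i j) = Bc c i j := by
  rcases lt_trichotomy i j with h | h | h
  · unfold BB Bc
    rw [if_pos h, eval_Bpoly, if_pos h]
  · subst h; simp [BB, Bc]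
  · rw [Bc_skew]
    unfold BB Bc
    rw [if_neg h.not_gt, if_pos h, map_neg, eval_Bpoly, if_pos h]

open Classical in
lemma eval_sum {m ν k : ℕ} {ι : Type*} [Fintype ι] [DecidableEq ι] (c : Fin m → Fin (2 * ν))
    (e : ι ⊕ Fin k × Bool ≃ Fin m) (f : ι → Fin (2 * ν)) :
    eval (ptc c) (∑ t ∈ Finset.univ.filter (fun t => InT e t),
      gT e (fun b i => (X (i, f b) : MvPolynomial (Fin m × Fin (2 * ν)) ℤ)) (BB (2 * ν) m) t) =
      hSum e (Vc c f) (Bc c) := by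
  unfold hSum
  rw [map_sum]
  refine Finset.sum_congr rfl fun t _ => ?_
  unfold gT sTerm hTerm
  simp only [map_zsmul, map_mul, map_prod, eval_X, eval_BB, smul_eq_mul, ptc, Vc]

/-- multidegree weight -/
def wt {m n : ℕ} (p : Fin m × Fin n) : Fin m → ℕ := Pi.single p.1 1

lemma hom_Bpoly {m n : ℕ} (i j : Fin m) :
    IsWeightedHomogeneous wt (Bpoly n m i j) (Pi.single i 1 + Pi.single j 1) := by
  unfold Bpoly
  have hX : ∀ (a b : Fin n) (i j : Fin m), IsWeightedHomogeneous wt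
      (X (i, a) * X (j, b) : MvPolynomial (Fin m × Fin n) ℤ) (Pi.single i 1 + Pi.single j 1) :=
    fun a b i j => (isWeightedHomogeneous_X ℤ wt (i, a)).mul (isWeightedHomogeneous_X ℤ wt (j, b))
  apply IsWeightedHomogeneous.add
  · apply IsWeightedHomogeneous.sum
    intro r _
    exact (hX _ _ _ _).add (hX _ _ _ _)
  · split_ifs with h
    · rw [mul_assoc, two_mul]
      exact (hX _ _ _ _).add (hX _ _ _ _)
    · exact isWeightedHomogeneous_zero _ _ _

lemma hom_neg {m n : ℕ} {P : MvPolynomial (Fin m × Fin n) ℤ} {d : Fin m → ℕ}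
    (h : IsWeightedHomogeneous wt P d) : IsWeightedHomogeneous wt (-P) d := by
  intro e he
  apply h
  simpa using he

lemma hom_zsmul {m n : ℕ} {P : MvPolynomial (Fin m × Fin n) ℤ} {d : Fin m → ℕ} (z : ℤ)
    (h : IsWeightedHomogeneous wt P d) : IsWeightedHomogeneous wt (z • P) d := by
  intro e he
  apply h
  intro h0
  apply he
  rw [coeff_smul, h0, smul_zero]

lemma hom_BB {m n : ℕ} (i j : Fin m) :
    IsWeightedHomogeneous wt (BB n m i j) (Pi.single i 1 + Pi.single j 1) := by
  unfold BB
  split_ifs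
  · exact hom_Bpoly i j
  · rw [add_comm]; exact hom_neg (hom_Bpoly j i)
  · exact isWeightedHomogeneous_zero _ _ _

lemma hom_gT {m n : ℕ} {ι κ : Type*} [Fintype ι] [Fintype κ] (e : ι ⊕ κ × Bool ≃ Fin m)
    (f : ι → Fin n) (t : Equiv.Perm (Fin m)) :
    IsWeightedHomogeneous wt (gT e (fun b i => (X (i, f b) : MvPolynomial (Fin m × Fin n) ℤ))
      (BB n m) t) (fun _ => 1) := by
  unfold gT
  apply hom_zsmul
  have h1 : IsWeightedHomogeneous wt (∏ b, (X (t (e (Sum.inl b)), f b) :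
      MvPolynomial (Fin m × Fin n) ℤ)) (∑ b, Pi.single (t (e (Sum.inl b))) 1) :=
    IsWeightedHomogeneous.prod _ _ _ fun b _ => isWeightedHomogeneous_X ℤ wt _
  have h2 : IsWeightedHomogeneous wt (∏ a, BB n m (t (e (Sum.inr (a, false))))
      (t (e (Sum.inr (a, true))))) (∑ a, (Pi.single (t (e (Sum.inr (a, false)))) 1 +
        Pi.single (t (e (Sum.inr (a, true)))) 1)) :=
    IsWeightedHomogeneous.prod _ _ _ fun b _ => hom_BB _ _
  have h3 := h1.mul h2
  convert h3 using 1
  have h4 : ∑ z, (Pi.single (t (e z)) 1 : Fin m → ℕ) = ∑ i, Pi.single i 1 :=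
    (e.trans t).sum_comp (fun i => (Pi.single i 1 : Fin m → ℕ))
  rw [Fintype.sum_sum_type, Fintype.sum_prod_type] at h4
  simp only [Fintype.sum_bool] at h4
  have h5 : ∑ i, (Pi.single i 1 : Fin m → ℕ) = fun _ => 1 :=
    Finset.univ_sum_single (fun _ : Fin m => 1)
  rw [← h5, ← h4]
  congr 1
  refine Finset.sum_congr rfl fun a _ => add_comm _ _

lemma expOf_apply {m n : ℕ} (c : Fin m → Fin n) (p : Fin m × Fin n) :
    expOf c p = if c p.1 = p.2 then 1 else 0 := by
  unfold expOf
  rw [Finsupp.finsetSum_apply, Finset.sum_eq_single p.1]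
  · rw [Finsupp.single_apply]
    have : (p.1, c p.1) = p ↔ c p.1 = p.2 := by
      rw [Prod.ext_iff]; simp
    simp only [this]
  · intro i _ hi
    rw [Finsupp.single_apply, if_neg]
    intro h
    exact hi (by rw [← h])
  · intro h; exact absurd (Finset.mem_univ _) h

lemma expOf_inj {m n : ℕ} : Function.Injective (expOf : (Fin m → Fin n) → _) := by
  intro c c' h
  funext i
  have h1 := expOf_apply c (i, c i)
  rw [h, expOf_apply] at h1
  simp only [if_true] at h1
  by_contra hne
  rw [if_neg (fun h => hne h.symm)] at h1
  exact absurd h1 (by norm_num)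

lemma exists_expOf {m n : ℕ} (d : (Fin m × Fin n) →₀ ℕ)
    (hd : Finsupp.weight wt d = fun _ : Fin m => 1) : ∃ c : Fin m → Fin n, d = expOf c := by
  have h1 : ∀ i : Fin m, ∑ a, d (i, a) = 1 := by
    intro i
    have := congrFun hd i
    rw [Finsupp.weight_apply, Finsupp.sum_fintype _ _ (by simp), Finset.sum_apply,
      Fintype.sum_prod_type] at this
    rw [← this, Finset.sum_eq_single i]
    · refine Finset.sum_congr rfl fun a _ => ?_
      simp [wt]
    · intro j _ hj
      apply Finset.sum_eq_zero
      intro a _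
      simp [wt, hj.symm]
    · intro h; exact absurd (Finset.mem_univ _) h
  have h2 : ∀ i : Fin m, ∃ a : Fin n, d (i, a) = 1 ∧ ∀ b, b ≠ a → d (i, b) = 0 := by
    intro i
    have hne : ∃ a ∈ Finset.univ, d (i, a) ≠ 0 := by
      apply Finset.exists_ne_zero_of_sum_ne_zero
      rw [h1]; norm_num
    obtain ⟨a, _, ha⟩ := hne
    have h3 := h1 i
    rw [← Finset.add_sum_erase _ _ (Finset.mem_univ a)] at h3
    have h4 : ∑ x ∈ Finset.univ.erase a, d (i, x) = 0 := by omega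
    refine ⟨a, by omega, fun b hb => ?_⟩
    rw [Finset.sum_eq_zero_iff] at h4
    exact h4 b (Finset.mem_erase.2 ⟨hb, Finset.mem_univ _⟩)
  choose c hc1 hc2 using h2
  refine ⟨c, ?_⟩
  ext ⟨i, a⟩
  rw [expOf_apply]
  simp only
  split_ifs with h
  · rw [← h]; exact hc1 i
  · exact hc2 i a (fun h' => h h'.symm)

lemma coeff_eq_eval {m n : ℕ} (P : MvPolynomial (Fin m × Fin n) ℤ)
    (hP : IsWeightedHomogeneous wt P (fun _ : Fin m => 1)) (c : Fin m → Fin n) :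
    coeff (expOf c) P = eval (ptc c) P := by
  rw [eval_eq', Finset.sum_eq_single (expOf c)]
  · rw [Finset.prod_eq_one, mul_one]
    intro p _
    rw [expOf_apply, ptc]
    split_ifs <;> simp
  · intro d hd hne
    rw [mem_support_iff] at hd
    obtain ⟨c', rfl⟩ := exists_expOf d (hP hd)
    have : ∃ i, c' i ≠ c i := by
      by_contra hcon
      push Not at hcon
      exact hne (by rw [funext hcon])
    obtain ⟨i, hi⟩ := this
    rw [Finset.prod_eq_zero (Finset.mem_univ (i, c' i)), mul_zero]
    rw [expOf_apply, if_pos rfl, pow_one, ptc, if_neg (fun h => hi h.symm)]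
  · intro h
    rw [notMem_support_iff] at h
    rw [h, zero_mul]

end Part6

open Classical in
/-- For `m = 2μ ≥ n = 2ν` both even, the mod-2 reductions of `Pf/2^(μ−ν)` and of
`(Σ_π sgn π · D^{(π(1),…,π(n))} Pf^{(π(n+1),…,π(m))})/2^(μ−ν)` coincide, and both equal
the sum of all `m`-linear monomials in which each pair of letters `x_r, y_r` occurs a
strictly positive even number of times in alternating order. -/
theorem g_eq_h_mod_two (ν μ : ℕ) (hν : 1 ≤ ν) (hμ : ν ≤ μ)
    (gt ht : MvPolynomial (Fin (2*μ) × Fin (2*ν)) ℤ)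
    (hg : (2 ^ (μ - ν) : MvPolynomial (Fin (2*μ) × Fin (2*ν)) ℤ) * gt =
      pfaffian (Bmat (2*ν) μ))
    (hh : (2 ^ (μ - ν) : MvPolynomial (Fin (2*μ) × Fin (2*ν)) ℤ) * ht =
      DPfSum (2*ν) (2*μ) (by omega)) :
    MvPolynomial.map (Int.castRingHom (ZMod 2)) gt =
      MvPolynomial.map (Int.castRingHom (ZMod 2)) ht ∧
    MvPolynomial.map (Int.castRingHom (ZMod 2)) gt =
      ∑ c ∈ (Finset.univ.filter fun c : Fin (2*μ) → Fin (2*ν) =>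
          ∀ r < ν, Even (cnt c r) ∧ 1 ≤ cnt c r ∧ Alt c r),
        MvPolynomial.monomial (expOf c) (1 : ZMod 2) := by
  classical
  have hgE := pf_expand (Bmat (2*ν) μ)
    (fun (b : Empty) i => (X (i, (b.elim : Fin (2*ν))) : MvPolynomial (Fin (2*μ) × Fin (2*ν)) ℤ))
  have h : 2 * μ = 2 * ν + 2 * (μ - ν) := by omega
  have hhE := DPfSum_expand h (by omega)
  have hgH : IsWeightedHomogeneous wt (pfaffian (Bmat (2*ν) μ)) (fun _ : Fin (2*μ) => 1) := by
    rw [hgE]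
    exact IsWeightedHomogeneous.sum _ _ _ fun t _ =>
      hom_gT (ee1 μ) (fun b : Empty => (b.elim : Fin (2*ν))) t
  have hhH : IsWeightedHomogeneous wt (DPfSum (2*ν) (2*μ) (by omega))
      (fun _ : Fin (2*μ) => 1) := by
    rw [hhE]
    exact IsWeightedHomogeneous.sum _ _ _ fun t _ => hom_gT (ee2 h) id t
  have hco : ∀ (P : MvPolynomial (Fin (2*μ) × Fin (2*ν)) ℤ) (d : (Fin (2*μ) × Fin (2*ν)) →₀ ℕ),
      coeff d ((2 ^ (μ - ν) : MvPolynomial (Fin (2*μ) × Fin (2*ν)) ℤ) * P) =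
        2 ^ (μ - ν) * coeff d P := by
    intro P d
    have : (2 ^ (μ - ν) : MvPolynomial (Fin (2*μ) × Fin (2*ν)) ℤ) = C (2 ^ (μ - ν)) := by
      simp
    rw [this, coeff_C_mul]
  have hg1 : ∀ c : Fin (2*μ) → Fin (2*ν), Odd (coeff (expOf c) gt) ↔
      ∀ r < ν, Even (cnt c r) ∧ 1 ≤ cnt c r ∧ Alt c r := by
    intro c
    apply g_odd_iff c (ee1 μ) (fun b : Empty => (b.elim : Fin (2*ν))) hμ
    rw [← hco, hg, coeff_eq_eval _ hgH, hgE]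
    exact eval_sum c (ee1 μ) (fun b : Empty => (b.elim : Fin (2*ν)))
  have hh1 : ∀ c : Fin (2*μ) → Fin (2*ν), Odd (coeff (expOf c) ht) ↔
      ∀ r < ν, Even (cnt c r) ∧ 1 ≤ cnt c r ∧ Alt c r := by
    intro c
    apply h_odd_iff c (ee2 h)
    rw [← hco, hh, coeff_eq_eval _ hhH, hhE]
    exact eval_sum c (ee2 h) id
  have final : ∀ (P Q : MvPolynomial (Fin (2*μ) × Fin (2*ν)) ℤ),
      (2 ^ (μ - ν) : MvPolynomial (Fin (2*μ) × Fin (2*ν)) ℤ) * P = Q →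
      IsWeightedHomogeneous wt Q (fun _ : Fin (2*μ) => 1) →
      (∀ c : Fin (2*μ) → Fin (2*ν), Odd (coeff (expOf c) P) ↔
        ∀ r < ν, Even (cnt c r) ∧ 1 ≤ cnt c r ∧ Alt c r) →
      MvPolynomial.map (Int.castRingHom (ZMod 2)) P =
      ∑ c ∈ (Finset.univ.filter fun c : Fin (2*μ) → Fin (2*ν) =>
          ∀ r < ν, Even (cnt c r) ∧ 1 ≤ cnt c r ∧ Alt c r),
        MvPolynomial.monomial (expOf c) (1 : ZMod 2) := by
    intro P Q hPQ hQ hP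
    ext d
    rw [coeff_map, coeff_sum]
    simp only [coeff_monomial]
    by_cases hd : ∃ c : Fin (2*μ) → Fin (2*ν), d = expOf c
    · obtain ⟨c, rfl⟩ := hd
      simp only [expOf_inj.eq_iff, Finset.sum_ite_eq', Finset.mem_filter, Finset.mem_univ, true_and]
      split_ifs with ho <;> rw [← hP c] at ho
      · exact (ZMod.intCast_eq_one_iff_odd).2 ho
      · rw [Int.not_odd_iff_even] at ho
        exact (ZMod.intCast_eq_zero_iff_even).2 ho
    · have h0 : coeff d P = 0 := by
        by_contra hne
        apply hd
        apply exists_expOf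
        apply hQ
        rw [← hPQ, hco]
        exact mul_ne_zero (by positivity) hne
      rw [h0, map_zero, Finset.sum_eq_zero]
      intro c _
      rw [if_neg]
      exact fun hc => hd ⟨c, hc.symm⟩
  have r1 := final gt _ hg hgH hg1
  have r2 := final ht _ hh hhH hh1
  exact ⟨r1.trans r2.symm, r1⟩
end

section
/- Let m > n ≥ 2 both be even, n = 2ν, m = 2μ. The mod-2 O(n)-invariant g = (Pfaffian of (B⁽ⁱʲ⁾))/2^{μ−ν} reduced mod 2 is an indecomposable invariant: it does not lie in the subalgebra of the invariant ring generated by invariants of degree strictly less than m. -/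
open MvPolynomial

/-- The standard quadratic form `x₁y₁ + ⋯ + x_ν y_ν (+ z²)` on `n`-space. -/
def stdQ (F : Type*) [CommRing F] (n : ℕ) (v : Fin n → F) : F :=
  (∑ r : Fin (n/2), v ⟨2*r.1, by have := r.2; omega⟩ * v ⟨2*r.1+1, by have := r.2; omega⟩)
  + if h : n % 2 = 1 then (v ⟨n-1, by omega⟩)^2 else 0


/-- The action of a matrix `g` on polynomials in the coordinates of `m` vectors,
substituting `v ↦ g v` in each vector variable. -/
noncomputable def substAct {k : Type*} [CommSemiring k] {m n : ℕ}
    (g : Matrix (Fin n) (Fin n) k) :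
    MvPolynomial (Fin m × Fin n) k →ₐ[k] MvPolynomial (Fin m × Fin n) k :=
  MvPolynomial.aeval fun ic => ∑ c : Fin n, MvPolynomial.C (g ic.2 c) * MvPolynomial.X (ic.1, c)


/-- Membership in the orthogonal group `O(n)`: an invertible matrix preserving `stdQ`. -/
def inO {k : Type*} [CommRing k] {n : ℕ} (g : Matrix (Fin n) (Fin n) k) : Prop :=
  IsUnit g.det ∧ ∀ v : Fin n → k, stdQ k n (g.mulVec v) = stdQ k n v


namespace GInd

open Finset

def cx {ν : ℕ} (r : Fin ν) : Fin (2*ν) := ⟨2*r.1, by have := r.2; omega⟩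
def cy {ν : ℕ} (r : Fin ν) : Fin (2*ν) := ⟨2*r.1+1, by have := r.2; omega⟩

lemma cx_inj {ν : ℕ} {r s : Fin ν} : cx r = cx s ↔ r = s := by
  simp [cx, Fin.ext_iff]
lemma cy_inj {ν : ℕ} {r s : Fin ν} : cy r = cy s ↔ r = s := by
  simp [cy, Fin.ext_iff]
lemma cx_ne_cy {ν : ℕ} {r s : Fin ν} : cx r ≠ cy s := by
  simp only [cx, cy, ne_eq, Fin.ext_iff]; omega
lemma cy_ne_cx {ν : ℕ} {r s : Fin ν} : cy r ≠ cx s := cx_ne_cy.symm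

lemma coord_cases {ν : ℕ} (c : Fin (2*ν)) : ∃ r, c = cx r ∨ c = cy r := by
  have := c.2
  refine ⟨⟨c.1/2, by omega⟩, ?_⟩
  simp only [cx, cy, Fin.ext_iff]; omega

lemma vec_ext {ν : ℕ} {R : Type*} {v w : Fin (2*ν) → R} (hx : ∀ r, v (cx r) = w (cx r))
    (hy : ∀ r, v (cy r) = w (cy r)) : v = w := by
  funext c
  obtain ⟨r, rfl | rfl⟩ := coord_cases c
  · exact hx r
  · exact hy r

lemma sum_half {ν : ℕ} {M : Type*} [AddCommMonoid M] (f : Fin ν → M)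
    (g : Fin (2*ν/2) → M) (h : ∀ (r : Fin (2*ν/2)) (hr : r.1 < ν), g r = f ⟨r.1, hr⟩) :
    ∑ r, g r = ∑ r, f r := by
  have e : 2*ν/2 = ν := by omega
  exact Fintype.sum_equiv (finCongr e) _ _ (fun r => h r (by have := r.2; omega))

lemma stdQ_eq {ν : ℕ} {k : Type*} [CommRing k] (v : Fin (2*ν) → k) :
    stdQ k (2*ν) v = ∑ r : Fin ν, v (cx r) * v (cy r) := by
  unfold stdQ
  rw [dif_neg (by omega), add_zero]
  exact sum_half (fun r => v (cx r) * v (cy r)) _ (fun r hr => rfl)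

/-- basis vectors: `true` gives `s_r`, `false` gives `t_r` -/
def bvec (R : Type*) [CommRing R] {ν : ℕ} (r : Fin ν) (b : Bool) : Fin (2*ν) → R :=
  fun c => if c = cx r then 1 else if c = cy r then (if b then 0 else 1) else 0

lemma bvec_cx (R : Type*) [CommRing R] {ν : ℕ} (r s : Fin ν) (b : Bool) :
    bvec R r b (cx s) = if s = r then 1 else 0 := by
  simp [bvec, cx_inj, cx_ne_cy]

lemma bvec_cy (R : Type*) [CommRing R] {ν : ℕ} (r s : Fin ν) (b : Bool) :
    bvec R r b (cy s) = if s = r then (if b then 0 else 1) else 0 := by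
  simp [bvec, cy_inj, cy_ne_cx]

section multilinear

set_option linter.unusedSectionVars false
set_option linter.unusedSimpArgs false

variable {k : Type*} [Field k] [CharP k 2] {ν : ℕ} {ι : Type*} [Fintype ι] [DecidableEq ι]

/-- swap of `x_ρ` and `y_ρ` -/
def swapL (k : Type*) [Field k] {ν : ℕ} (ρ : Fin ν) : (Fin (2*ν) → k) →ₗ[k] (Fin (2*ν) → k) :=
  LinearMap.funLeft k k (Equiv.swap (cx ρ) (cy ρ))

lemma swapL_inj (ρ : Fin ν) : Function.Injective (swapL k ρ) :=
  LinearMap.funLeft_injective_of_surjective k k _ (Equiv.surjective _)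

lemma swapL_apply (ρ : Fin ν) (v : Fin (2*ν) → k) (c) :
    swapL k ρ v c = v (Equiv.swap (cx ρ) (cy ρ) c) := rfl

lemma swapL_cx (ρ r : Fin ν) (v : Fin (2*ν) → k) :
    swapL k ρ v (cx r) = if r = ρ then v (cy ρ) else v (cx r) := by
  rw [swapL_apply]
  split_ifs with h
  · subst h; simp
  · rw [Equiv.swap_apply_of_ne_of_ne (by rwa [ne_eq, cx_inj]) cx_ne_cy]

lemma swapL_cy (ρ r : Fin ν) (v : Fin (2*ν) → k) :
    swapL k ρ v (cy r) = if r = ρ then v (cx ρ) else v (cy r) := by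
  rw [swapL_apply]
  split_ifs with h
  · subst h; simp
  · rw [Equiv.swap_apply_of_ne_of_ne cy_ne_cx (by rwa [ne_eq, cy_inj])]

lemma swapL_Q (ρ : Fin ν) (v : Fin (2*ν) → k) :
    stdQ k (2*ν) (swapL k ρ v) = stdQ k (2*ν) v := by
  rw [stdQ_eq, stdQ_eq]
  refine Finset.sum_congr rfl fun r _ => ?_
  rw [swapL_cx, swapL_cy]
  split_ifs with h
  · subst h; ring
  · rfl

/-- the mixing transformation -/
def mixF {k : Type*} [Field k] {ν : ℕ} (r ρ : Fin ν) (l : k) (v : Fin (2*ν) → k) :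
    Fin (2*ν) → k := fun c =>
  if c = cx r then l⁻¹ * (v (cx r) + v (cy r) + (1 + l) * (v (cx ρ) + v (cy ρ))) + l * v (cy r)
  else if c = cy r then l * v (cy r)
  else if c = cx ρ then v (cx ρ) + (1 + l) * v (cy r)
  else if c = cy ρ then v (cy ρ) + (1 + l) * v (cy r)
  else v c

def mixL {k : Type*} [Field k] {ν : ℕ} (r ρ : Fin ν) (l : k) :
    (Fin (2*ν) → k) →ₗ[k] (Fin (2*ν) → k) where
  toFun := mixF r ρ l
  map_add' v w := by
    funext c
    simp only [mixF, Pi.add_apply]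
    split_ifs <;> ring
  map_smul' a v := by
    funext c
    simp only [mixF, Pi.smul_apply, smul_eq_mul, RingHom.id_apply]
    split_ifs <;> ring

lemma mixL_cx {r ρ : Fin ν} (l : k) (v : Fin (2*ν) → k) (a : Fin ν) :
    mixL r ρ l v (cx a) =
      if a = r then l⁻¹ * (v (cx r) + v (cy r) + (1 + l) * (v (cx ρ) + v (cy ρ))) + l * v (cy r)
      else if a = ρ then v (cx ρ) + (1 + l) * v (cy r) else v (cx a) := by
  change mixF r ρ l v (cx a) = _
  simp [mixF, cx_inj, cx_ne_cy]

lemma mixL_cy {r ρ : Fin ν} (l : k) (v : Fin (2*ν) → k) (a : Fin ν) :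
    mixL r ρ l v (cy a) =
      if a = r then l * v (cy r)
      else if a = ρ then v (cy ρ) + (1 + l) * v (cy r) else v (cy a) := by
  change mixF r ρ l v (cy a) = _
  simp [mixF, cy_inj, cy_ne_cx]

lemma mixL_inj {r ρ : Fin ν} (h : r ≠ ρ) {l : k} (hl : l ≠ 0) :
    Function.Injective (mixL r ρ l) := by
  rw [injective_iff_map_eq_zero]
  intro v hv
  have hX : ∀ a, mixL r ρ l v (cx a) = 0 := fun a => by rw [hv]; rfl
  have hY : ∀ a, mixL r ρ l v (cy a) = 0 := fun a => by rw [hv]; rfl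
  simp only [mixL_cx] at hX
  simp only [mixL_cy] at hY
  have h1 : v (cy r) = 0 := by simpa [hl] using hY r
  have h2 : v (cy ρ) = 0 := by simpa [h.symm, h1] using hY ρ
  have h3 : v (cx ρ) = 0 := by simpa [h.symm, h1] using hX ρ
  have h4 : v (cx r) = 0 := by simpa [hl, h1, h2, h3] using hX r
  refine vec_ext (fun a => ?_) (fun a => ?_)
  · by_cases ha : a = r
    · subst ha; exact h4
    by_cases ha' : a = ρ
    · subst ha'; exact h3
    simpa [ha, ha'] using hX a
  · by_cases ha : a = r
    · subst ha; exact h1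
    by_cases ha' : a = ρ
    · subst ha'; exact h2
    simpa [ha, ha'] using hY a

lemma mixL_Q {r ρ : Fin ν} (h : r ≠ ρ) {l : k} (hl : l ≠ 0) (v : Fin (2*ν) → k) :
    stdQ k (2*ν) (mixL r ρ l v) = stdQ k (2*ν) v := by
  rw [stdQ_eq, stdQ_eq]
  have hρ : ρ ∈ (univ : Finset (Fin ν)).erase r := by simp [h.symm]
  rw [← Finset.add_sum_erase _ _ (mem_univ r), ← Finset.add_sum_erase _ _ hρ,
    ← Finset.add_sum_erase _ (fun r => v (cx r) * v (cy r)) (mem_univ r),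
    ← Finset.add_sum_erase _ (fun r => v (cx r) * v (cy r)) hρ, ← add_assoc, ← add_assoc]
  congr 1
  · simp only [mixL_cx, mixL_cy, if_true, if_neg h.symm]
    have h2 : (2 : k) = 0 := CharTwo.two_eq_zero
    field_simp
    linear_combination (v (cx ρ) * v (cy r) * (1 + l) + v (cy ρ) * v (cy r) * (1+l) +
      v (cy r)^2 * (1 + l + l^2)) * h2
  · refine Finset.sum_congr rfl fun a ha => ?_
    simp only [mem_erase, mem_univ, and_true] at ha
    simp only [mixL_cx, mixL_cy, if_neg ha.1, if_neg ha.2]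

variable (F : MultilinearMap k (fun _ : ι => (Fin (2*ν) → k)) k)

lemma F_t_zero
  (hF : ∀ L : (Fin (2*ν) → k) →ₗ[k] (Fin (2*ν) → k), Function.Injective L →
    (∀ v, stdQ k (2*ν) (L v) = stdQ k (2*ν) v) → ∀ w : ι → (Fin (2*ν) → k),
      F (fun i => L (w i)) = F w)
    (ρ : Fin ν) (w : ι → (Fin (2*ν) → k)) (hw : ∀ i, w i (cx ρ) = w i (cy ρ)) (i₀ : ι) :
    F (Function.update w i₀ (bvec k ρ false)) = 0 := by
  have h := hF (swapL k ρ) (swapL_inj ρ) (swapL_Q ρ) (Function.update w i₀ (bvec k ρ true))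
  have e : (fun i => swapL k ρ (Function.update w i₀ (bvec k ρ true) i)) =
      Function.update w i₀ (bvec k ρ false + bvec k ρ true) := by
    funext i
    by_cases hi : i = i₀
    · subst hi
      rw [Function.update_self, Function.update_self]
      refine vec_ext (fun r => ?_) (fun r => ?_)
      · simp only [swapL_cx, Pi.add_apply, bvec_cx, bvec_cy]
        have h2 : (1 + 1 : k) = 0 := CharTwo.add_self_eq_zero 1
        split_ifs <;> simp_all
      · simp only [swapL_cy, Pi.add_apply, bvec_cx, bvec_cy]
        split_ifs <;> simp_all
    · rw [Function.update_of_ne hi, Function.update_of_ne hi]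
      refine vec_ext (fun r => ?_) (fun r => ?_)
      · rw [swapL_cx]; split_ifs with hr
        · subst hr; exact (hw i).symm
        · rfl
      · rw [swapL_cy]; split_ifs with hr
        · subst hr; exact (hw i)
        · rfl
  rw [e, MultilinearMap.map_update_add] at h
  simpa using h

lemma F_add_t
  (hF : ∀ L : (Fin (2*ν) → k) →ₗ[k] (Fin (2*ν) → k), Function.Injective L →
    (∀ v, stdQ k (2*ν) (L v) = stdQ k (2*ν) v) → ∀ w : ι → (Fin (2*ν) → k),
      F (fun i => L (w i)) = F w)
    (ρ : Fin ν) (w : ι → (Fin (2*ν) → k)) (hw : ∀ i, w i (cx ρ) = w i (cy ρ))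
    (c : ι → k) : F (fun i => w i + c i • bvec k ρ false) = F w := by
  have key : ∀ s : Finset ι, F (fun i => if i ∈ s then w i + c i • bvec k ρ false else w i) = F w := by
    intro s
    induction s using Finset.induction_on with
    | empty => simp
    | insert j s hj ih =>
      rw [← ih]
      set g : ι → (Fin (2*ν) → k) := fun i => if i ∈ s then w i + c i • bvec k ρ false else w i
        with hg
      have e : (fun i => if i ∈ insert j s then w i + c i • bvec k ρ false else w i) =
          Function.update g j (g j + c j • bvec k ρ false) := by
        funext i
        by_cases hi : i = j
        · subst hi; simp [hg, hj]
        · simp [hg, hi]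
      have hgf : ∀ i, g i (cx ρ) = g i (cy ρ) := by
        intro i
        simp only [hg]
        split_ifs <;> simp [hw i, bvec_cx, bvec_cy]
      rw [e, MultilinearMap.map_update_add, MultilinearMap.map_update_smul,
        F_t_zero F hF ρ g hgf j, Function.update_eq_self]
      simp
  simpa using key univ

lemma F_balance [Infinite k]
  (hF : ∀ L : (Fin (2*ν) → k) →ₗ[k] (Fin (2*ν) → k), Function.Injective L →
    (∀ v, stdQ k (2*ν) (L v) = stdQ k (2*ν) v) → ∀ w : ι → (Fin (2*ν) → k),
      F (fun i => L (w i)) = F w)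
    (r : ι → Fin ν) (b : ι → Bool) (ρ r₀ : Fin ν) (hρ : ∀ i, r i ≠ ρ)
    (hr₀ : r₀ ≠ ρ) (hne : F (fun i => bvec k (r i) (b i)) ≠ 0) :
    #{i | r i = r₀ ∧ b i = true} = #{i | r i = r₀ ∧ b i = false} := by
  classical
  by_contra hab
  set A := #{i | r i = r₀ ∧ b i = true} with hA
  set B := #{i | r i = r₀ ∧ b i = false} with hB
  obtain ⟨l, hl0, hl⟩ : ∃ l : k, l ≠ 0 ∧ l ^ A ≠ l ^ B := by
    let P : Polynomial k := Polynomial.X * (Polynomial.X ^ A - Polynomial.X ^ B)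
    have hP : P ≠ 0 := by
      refine mul_ne_zero Polynomial.X_ne_zero (sub_ne_zero.2 fun h => hab ?_)
      simpa using congrArg Polynomial.natDegree h
    obtain ⟨l, hl⟩ := Infinite.exists_notMem_finset P.roots.toFinset
    have : P.eval l ≠ 0 := by
      intro h
      exact hl (by simpa [hP] using h)
    simp only [P, Polynomial.eval_mul, Polynomial.eval_sub, Polynomial.eval_pow,
      Polynomial.eval_X, mul_ne_zero_iff, sub_ne_zero] at this
    exact ⟨l, this⟩
  let lam : ι → k := fun i => (if r i = r₀ ∧ b i = true then l⁻¹ else 1) *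
    (if r i = r₀ ∧ b i = false then l else 1)
  let c : ι → k := fun i => if r i = r₀ ∧ b i = false then 1 + l else 0
  have e : ∀ i, mixL r₀ ρ l (bvec k (r i) (b i)) =
      lam i • bvec k (r i) (b i) + c i • bvec k ρ false := by
    intro i
    have h1 : r i ≠ ρ := hρ i
    have h2 : (1 + 1 : k) = 0 := CharTwo.add_self_eq_zero 1
    refine vec_ext (fun a => ?_) (fun a => ?_)
    · rw [mixL_cx]
      simp only [bvec_cx, bvec_cy, Pi.add_apply, Pi.smul_apply, smul_eq_mul, lam, c, h1.symm,
        hr₀, hr₀.symm, if_false]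
      by_cases hi : r i = r₀
      · rw [hi]
        cases hb : b i <;> by_cases ha : a = r₀
        · subst ha; simp [hr₀, h2]
        · by_cases ha' : a = ρ <;> simp [ha, ha', hr₀.symm]
        · subst ha; simp [hr₀]
        · by_cases ha' : a = ρ <;> simp [ha, ha', hr₀.symm]
      · by_cases ha : a = r₀
        · subst ha; simp [hi, Ne.symm hi]
        · by_cases ha' : a = ρ
          · subst ha'; simp [ha, hi, h1.symm, Ne.symm hi]
          · simp [ha, ha', hi, Ne.symm hi]
    · rw [mixL_cy]
      simp only [bvec_cx, bvec_cy, Pi.add_apply, Pi.smul_apply, smul_eq_mul, lam, c, h1.symm,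
        hr₀, hr₀.symm, if_false]
      by_cases hi : r i = r₀
      · rw [hi]
        cases hb : b i <;> by_cases ha : a = r₀
        · subst ha; simp [hr₀, h2]
        · by_cases ha' : a = ρ <;> simp [ha, ha', hr₀.symm]
        · subst ha; simp [hr₀]
        · by_cases ha' : a = ρ <;> simp [ha, ha', hr₀.symm]
      · by_cases ha : a = r₀
        · subst ha; simp [hi, Ne.symm hi]
        · by_cases ha' : a = ρ
          · subst ha'; simp [ha, hi, h1.symm, Ne.symm hi]
          · simp [ha, ha', hi, Ne.symm hi]
  have h := hF (mixL r₀ ρ l) (mixL_inj hr₀ hl0) (mixL_Q hr₀ hl0) (fun i => bvec k (r i) (b i))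
  simp only [e] at h
  rw [F_add_t F hF ρ (fun i => lam i • bvec k (r i) (b i))
    (fun i => by simp [bvec_cx, bvec_cy, (hρ i).symm]) c, MultilinearMap.map_smul_univ] at h
  have h1 : ∏ i, lam i = 1 := by
    simpa [hne] using h
  have h3 : ∏ i, lam i = l⁻¹ ^ A * l ^ B := by
    simp only [lam, Finset.prod_mul_distrib]
    rw [Finset.prod_ite, Finset.prod_ite]
    simp [hA, hB]
  rw [h3, inv_pow, inv_mul_eq_one₀ (pow_ne_zero _ hl0)] at h1
  exact hl h1

lemma F_bound [Infinite k]
  (hF : ∀ L : (Fin (2*ν) → k) →ₗ[k] (Fin (2*ν) → k), Function.Injective L →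
    (∀ v, stdQ k (2*ν) (L v) = stdQ k (2*ν) v) → ∀ w : ι → (Fin (2*ν) → k),
      F (fun i => L (w i)) = F w)
    (r : ι → Fin ν) (b : ι → Bool)
    (hne : F (fun i => bvec k (r i) (b i)) ≠ 0) :
    min (Fintype.card ι) (2*ν) ≤ 2 * #{i | b i = true} := by
  by_cases hs : ν ≤ #{i | b i = true}
  · omega
  push Not at hs
  obtain ⟨ρ, hρ⟩ : ∃ ρ, ρ ∉ ({i | b i = true} : Finset ι).image r := by
    by_contra! hall
    have : (univ : Finset (Fin ν)) ⊆ ({i | b i = true} : Finset ι).image r := fun x _ => hall x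
    have h1 := Finset.card_le_card this
    have h2 := Finset.card_image_le (s := ({i | b i = true} : Finset ι)) (f := r)
    simp at h1
    omega
  simp only [mem_image, mem_filter, mem_univ, true_and, not_exists, not_and] at hρ
  have hnr : ∀ i, r i ≠ ρ := by
    intro i hi
    have hb : b i = false := by
      by_contra hb
      exact hρ i (by simpa using hb) hi
    refine hne ?_
    have := F_t_zero F hF ρ (fun i => bvec k (r i) (b i)) (fun j => by
      simp only [bvec_cx, bvec_cy]
      split_ifs with h1 h2
      · exact absurd h1.symm (hρ j h2)
      · rfl
      · rfl) i
    rwa [← hi, ← hb, Function.update_eq_self i (fun i => bvec k (r i) (b i))] at this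
  have hbal : ∀ r₀ : Fin ν, #{i | r i = r₀ ∧ b i = true} = #{i | r i = r₀ ∧ b i = false} := by
    intro r₀
    by_cases h : r₀ = ρ
    · subst h; simp [hnr]
    · exact F_balance F hF r b ρ r₀ hnr h hne
  have hsum : ∀ β, #{i | b i = β} = ∑ r₀, #{i | r i = r₀ ∧ b i = β} := by
    intro β
    rw [Finset.card_eq_sum_card_fiberwise (f := r) (t := univ) (fun _ _ => by simp)]
    refine Finset.sum_congr rfl fun r₀ _ => ?_
    rw [Finset.filter_filter]
    simp only [and_comm]
  have h1 : #{i | b i = true} = #{i | b i = false} := by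
    rw [hsum, hsum]; exact Finset.sum_congr rfl fun r₀ _ => hbal r₀
  have h2 := Finset.card_filter_add_card_filter_not (s := (univ : Finset ι)) (fun i => b i = true)
  simp only [Bool.not_eq_true, Finset.card_univ] at h2
  omega

end multilinear

section evaluation

/-- substitute `ε_i v_i` for the `i`-th vector -/
noncomputable def ev {R : Type*} [CommRing R] {m n : ℕ} (v : Fin m → Fin n → R) :
    MvPolynomial (Fin m × Fin n) R →ₐ[R] MvPolynomial (Fin m) R :=
  MvPolynomial.aeval fun ic => C (v ic.1 ic.2) * X ic.1

lemma ev_X {R : Type*} [CommRing R] {m n : ℕ} (v : Fin m → Fin n → R) (i : Fin m) (c : Fin n) :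
    ev v (X (i, c)) = C (v i c) * X i := by
  simp [ev]

lemma ev_subst {R : Type*} [CommRing R] {m n : ℕ} (v : Fin m → Fin n → R)
    (A : Matrix (Fin n) (Fin n) R) (p : MvPolynomial (Fin m × Fin n) R) :
    ev v (substAct A p) = ev (fun i => A.mulVec (v i)) p := by
  have : (ev v).comp (substAct A) = ev (fun i => A.mulVec (v i)) := by
    refine MvPolynomial.algHom_ext fun ic => ?_
    obtain ⟨i, a⟩ := ic
    rw [AlgHom.comp_apply, ev_X]
    simp only [substAct, aeval_X, map_sum, map_mul, ev_X, Matrix.mulVec, dotProduct,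
      Finset.sum_mul]
    refine Finset.sum_congr rfl fun c _ => ?_
    rw [← mul_assoc]
    congr 2
    exact (ev v).commutes _
  exact DFunLike.congr_fun this p

lemma ev_monomial {R : Type*} [CommRing R] {m n : ℕ} (v : Fin m → Fin n → R)
    (e : Fin m × Fin n →₀ ℕ) (a : R) :
    ev v (monomial e a) = monomial (Finsupp.equivFunOnFinite.symm fun i => ∑ c, e (i, c))
      (a * ∏ i, ∏ c, v i c ^ e (i, c)) := by
  rw [ev, aeval_monomial, monomial_eq (s := Finsupp.equivFunOnFinite.symm _),
    Finsupp.prod_fintype _ _ (by simp), Finsupp.prod_fintype _ _ (by simp)]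
  rw [Fintype.prod_prod_type]
  simp only [mul_pow, Finset.prod_mul_distrib, Finset.prod_pow_eq_pow_sum, map_mul, map_prod,
    map_pow, Finsupp.equivFunOnFinite_symm_apply_apply, algebraMap_eq, mul_assoc]

lemma coeff_ev {R : Type*} [CommRing R] {m n : ℕ} (v : Fin m → Fin n → R)
    (p : MvPolynomial (Fin m × Fin n) R) (d : Fin m →₀ ℕ) :
    coeff d (ev v p) = ∑ e ∈ p.support,
      if (Finsupp.equivFunOnFinite.symm fun i => ∑ c, e (i, c)) = d then
        coeff e p * ∏ i, ∏ c, v i c ^ e (i, c) else 0 := by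
  conv_lhs => rw [← support_sum_monomial_coeff p]
  rw [map_sum, coeff_sum]
  refine Finset.sum_congr rfl fun e _ => ?_
  rw [ev_monomial, coeff_monomial]

lemma degree_of_coeff_ev {R : Type*} [CommRing R] {m n : ℕ} (v : Fin m → Fin n → R)
    (p : MvPolynomial (Fin m × Fin n) R) (d : Fin m →₀ ℕ) (h : coeff d (ev v p) ≠ 0) :
    ∑ i, d i ≤ p.totalDegree := by
  rw [coeff_ev] at h
  obtain ⟨e, he, hne⟩ := Finset.exists_ne_zero_of_sum_ne_zero h
  have hd : (Finsupp.equivFunOnFinite.symm fun i => ∑ c, e (i, c)) = d := by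
    by_contra hd
    exact hne (if_neg hd)
  have := le_totalDegree he
  rw [Finsupp.sum_fintype _ _ (by simp), Fintype.sum_prod_type] at this
  subst hd
  simpa using this

lemma exists_multilinear {k : Type*} [Field k] {m n : ℕ} (p : MvPolynomial (Fin m × Fin n) k)
    (d : Fin m →₀ ℕ) (hd : ∀ i, d i ≤ 1) :
    ∃ F : MultilinearMap k (fun _ : d.support => (Fin n → k)) k,
      ∀ v : Fin m → Fin n → k, coeff d (ev v p) = F (fun i => v i) := by
  induction p using MvPolynomial.induction_on' with
  | add p q hp hq =>
    obtain ⟨F, hF⟩ := hp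
    obtain ⟨G, hG⟩ := hq
    exact ⟨F + G, fun v => by rw [map_add, coeff_add, hF, hG]; rfl⟩
  | monomial e a =>
    by_cases h : (Finsupp.equivFunOnFinite.symm fun i => ∑ c, e (i, c)) = d
    · have hs : ∀ i, ∑ c, e (i, c) = d i := fun i => by rw [← h]; rfl
      have hc : ∀ i : d.support, ∃ c, ∀ f : Fin n → k, ∏ c, f c ^ e (i, c) = f c := by
        intro i
        have h1 : d i = 1 := by
          have := hd i
          have := Finsupp.mem_support_iff.1 i.2
          omega
        have h2 := hs i
        rw [h1] at h2
        obtain ⟨c, -, hc⟩ := Finset.exists_ne_zero_of_sum_ne_zero (by rw [h2]; exact one_ne_zero)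
        rw [← Finset.add_sum_erase _ _ (Finset.mem_univ c)] at h2
        have h3 : e (i, c) = 1 := by omega
        have h4 : ∑ c ∈ univ.erase c, e (i, c) = 0 := by omega
        rw [Finset.sum_eq_zero_iff] at h4
        refine ⟨c, fun f => ?_⟩
        rw [← Finset.mul_prod_erase _ _ (Finset.mem_univ c), h3, pow_one,
          Finset.prod_eq_one, mul_one]
        intro c' hc'
        rw [h4 c' hc', pow_zero]
      choose c hc using hc
      refine ⟨a • (MultilinearMap.mkPiAlgebra k d.support k).compLinearMap
        (fun i => LinearMap.proj (c i)), fun v => ?_⟩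
      rw [ev_monomial, coeff_monomial, if_pos h]
      simp only [_root_.smul_apply, MultilinearMap.compLinearMap_apply,
        MultilinearMap.mkPiAlgebra_apply, LinearMap.proj_apply, smul_eq_mul]
      congr 1
      rw [← Finset.prod_subset (Finset.subset_univ d.support), ← Finset.prod_coe_sort]
      · exact Finset.prod_congr rfl fun i _ => hc i (v i)
      · intro i _ hi
        have h0 := hs i
        rw [Finsupp.notMem_support_iff.1 hi, Finset.sum_eq_zero_iff] at h0
        exact Finset.prod_eq_one fun c' hc' => by rw [h0 c' hc', pow_zero]
    · refine ⟨0, fun v => ?_⟩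
      rw [ev_monomial, coeff_monomial, if_neg h]
      rfl

lemma generator_bound {k : Type*} [Field k] [CharP k 2] [Infinite k] {m ν : ℕ}
    (p : MvPolynomial (Fin m × Fin (2*ν)) k)
    (hp : ∀ g : Matrix (Fin (2*ν)) (Fin (2*ν)) k, inO g → substAct g p = p)
    (r : Fin m → Fin ν) (b : Fin m → Bool) (d : Fin m →₀ ℕ) (hd : ∀ i, d i ≤ 1)
    (hne : coeff d (ev (fun i => bvec k (r i) (b i)) p) ≠ 0) :
    min (∑ i, d i) (2*ν) ≤ 2 * ∑ i, d i * (if b i then 1 else 0) := by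
  classical
  obtain ⟨F, hF⟩ := exists_multilinear p d hd
  have hinv : ∀ L : (Fin (2*ν) → k) →ₗ[k] (Fin (2*ν) → k), Function.Injective L →
    (∀ v, stdQ k (2*ν) (L v) = stdQ k (2*ν) v) → ∀ w : d.support → (Fin (2*ν) → k),
      F (fun i => L (w i)) = F w := by
    intro L hL hQ w
    have hmv : ∀ v, (LinearMap.toMatrix' L).mulVec v = L v := fun v => by
      rw [LinearMap.toMatrix'_mulVec]
    have hO : inO (LinearMap.toMatrix' L) := by
      refine ⟨?_, fun v => by rw [hmv, hQ]⟩
      rw [← Matrix.isUnit_iff_isUnit_det, ← Matrix.mulVec_injective_iff_isUnit]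
      intro v w h
      simp only [hmv] at h
      exact hL h
    let v : Fin m → Fin (2*ν) → k := fun i => if h : i ∈ d.support then w ⟨i, h⟩ else 0
    have hv : (fun i : d.support => v i) = w := by
      funext i
      have := i.2
      simp only [v]
      rw [dif_pos this]
    have h1 := hF v
    rw [← hp _ hO, ev_subst, hF, hv] at h1
    rw [← h1]
    congr 1
    funext i
    rw [hmv, ← hv]
  rw [hF] at hne
  have := F_bound F hinv (fun i => r i) (fun i => b i) hne
  have h1 : ∀ i, i ∈ d.support → d i = 1 := fun i hi => by
    have := hd i
    have := Finsupp.mem_support_iff.1 hi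
    omega
  have e1 : ∑ i, d i = Fintype.card d.support := by
    rw [← Finset.sum_subset (Finset.subset_univ d.support), Finset.sum_congr rfl h1]
    · rw [Fintype.card_coe, Finset.card_eq_sum_ones]
    · intro i _ hi
      exact Finsupp.notMem_support_iff.1 hi
  have e2 : ∑ i, d i * (if b i then 1 else 0) = #{i : d.support | b i = true} := by
    rw [← Finset.sum_subset (Finset.subset_univ d.support), ← Finset.sum_coe_sort,
      Finset.card_filter]
    · exact Finset.sum_congr rfl fun i _ => by rw [h1 i i.2, one_mul]
    · intro i _ hi
      rw [Finsupp.notMem_support_iff.1 hi, zero_mul]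
  rw [e1, e2]
  exact this

lemma adjoin_bound {k : Type*} [Field k] [CharP k 2] [Infinite k] {ν μ : ℕ} (hν : 1 ≤ ν)
    (hμν : ν < μ) (p : MvPolynomial (Fin (2*μ) × Fin (2*ν)) k)
    (hp : p ∈ Algebra.adjoin k {p : MvPolynomial (Fin (2*μ) × Fin (2*ν)) k |
        (∀ g : Matrix (Fin (2*ν)) (Fin (2*ν)) k, inO g → substAct g p = p) ∧
        p.totalDegree < 2*μ})
    (r : Fin (2*μ) → Fin ν) (b : Fin (2*μ) → Bool) :
    ∀ d : Fin (2*μ) →₀ ℕ, (∀ i, d i ≤ 1) →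
    coeff d (ev (fun i => bvec k (r i) (b i)) p) ≠ 0 →
    (∑ i, d i < 2*μ → min (∑ i, d i) (2*ν) ≤ 2 * ∑ i, d i * (if b i then 1 else 0)) ∧
    (∑ i, d i = 2*μ → ν < ∑ i, d i * (if b i then 1 else 0)) := by
  classical
  induction hp using Algebra.adjoin_induction with
  | mem p hp =>
    intro d hd hne
    have := degree_of_coeff_ev _ _ _ hne
    have h2 := hp.2
    exact ⟨fun _ => generator_bound p hp.1 r b d hd hne, fun h => by omega⟩
  | algebraMap a =>
    intro d hd hne
    rw [AlgHom.commutes, algebraMap_eq, coeff_C] at hne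
    have : d = 0 := by
      by_contra h
      exact hne (if_neg (Ne.symm h))
    subst this
    simp
    omega
  | add p q _ _ hp hq =>
    intro d hd hne
    rw [map_add, coeff_add] at hne
    by_cases h : coeff d (ev (fun i => bvec k (r i) (b i)) p) = 0
    · rw [h, zero_add] at hne
      exact hq d hd hne
    · exact hp d hd h
  | mul p q _ _ hp hq =>
    intro d hd hne
    rw [map_mul, coeff_mul] at hne
    obtain ⟨⟨d1, d2⟩, hmem, hne'⟩ := Finset.exists_ne_zero_of_sum_ne_zero hne
    clear hne
    rw [Finset.HasAntidiagonal.mem_antidiagonal] at hmem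
    simp only at hmem hne'
    subst hmem
    have h1 := hp d1 (fun i => by have := hd i; simp at this; omega) (left_ne_zero_of_mul hne')
    have h2 := hq d2 (fun i => by have := hd i; simp at this; omega) (right_ne_zero_of_mul hne')
    simp only [Finsupp.add_apply, add_mul, Finset.sum_add_distrib]
    omega

end evaluation

section pfaff

@[to_additive]
lemma prod_pairs {μ : ℕ} {M : Type*} [CommMonoid M] (f : Fin (2*μ) → M) :
    ∏ i : Fin μ, (f (cx i) * f (cy i)) = ∏ j, f j := by
  have hb : Function.Bijective (Sum.elim cx cy : Fin μ ⊕ Fin μ → Fin (2*μ)) := by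
    constructor
    · rintro (a | a) (b | b) h
      · simpa [cx_inj] using h
      · exact absurd h cx_ne_cy
      · exact absurd h cy_ne_cx
      · simpa [cy_inj] using h
    · intro c
      obtain ⟨r, rfl | rfl⟩ := coord_cases c
      · exact ⟨Sum.inl r, rfl⟩
      · exact ⟨Sum.inr r, rfl⟩
  rw [← (Equiv.ofBijective _ hb).prod_comp, Fintype.prod_sum_type, Finset.prod_mul_distrib]
  rfl

/-- the standard fixed point free involution -/
def pi0 (μ : ℕ) : Equiv.Perm (Fin (2*μ)) :=
  Function.Involutive.toPerm
    (fun c => if h : c.1 % 2 = 0 then ⟨c.1 + 1, by have := c.2; omega⟩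
      else ⟨c.1 - 1, by have := c.2; omega⟩)
    (by
      intro c
      by_cases h : c.1 % 2 = 0
      · have h' : ¬ (c.1 + 1) % 2 = 0 := by omega
        simp [h, h']
      · have h' : (c.1 - 1) % 2 = 0 := by omega
        simp only [h, h', dif_pos, dif_neg, not_false_iff, Fin.ext_iff]
        omega)

lemma pi0_cx {μ : ℕ} (i : Fin μ) : pi0 μ (cx i) = cy i := by
  simp [pi0, cx, cy, Function.Involutive.toPerm]

lemma pi0_cy {μ : ℕ} (i : Fin μ) : pi0 μ (cy i) = cx i := by
  rw [← pi0_cx]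
  exact Function.Involutive.leftInverse (f := pi0 μ) (by
    intro c; exact (pi0 μ).left_inv c) _

/-- fixed point free involutions -/
def IsFpf {μ : ℕ} (τ : Equiv.Perm (Fin (2*μ))) : Prop :=
  (∀ a, τ (τ a) = a) ∧ ∀ a, τ a ≠ a

lemma mem_pfPerms {μ : ℕ} {σ : Equiv.Perm (Fin (2*μ))} : σ ∈ pfPerms μ ↔
    (∀ i, σ (cx i) < σ (cy i)) ∧ ∀ i j, i < j → σ (cx i) < σ (cx j) := by
  simp [pfPerms, cx, cy]

lemma conj_fpf {μ : ℕ} (σ : Equiv.Perm (Fin (2*μ))) : IsFpf (σ * pi0 μ * σ⁻¹) := by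
  refine ⟨fun a => ?_, fun a => ?_⟩
  · obtain ⟨c, rfl⟩ := σ.surjective a
    obtain ⟨r, rfl | rfl⟩ := coord_cases c <;> simp [pi0_cx, pi0_cy]
  · obtain ⟨c, rfl⟩ := σ.surjective a
    obtain ⟨r, rfl | rfl⟩ := coord_cases c
    · simp [pi0_cx, cy_ne_cx]
    · simp [pi0_cy, cx_ne_cy]

lemma range_cx {μ : ℕ} {σ : Equiv.Perm (Fin (2*μ))} (hσ : σ ∈ pfPerms μ) :
    Set.range (fun i => σ (cx i)) = {a | a < (σ * pi0 μ * σ⁻¹) a} := by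
  rw [mem_pfPerms] at hσ
  ext a
  obtain ⟨c, rfl⟩ := σ.surjective a
  obtain ⟨r, rfl | rfl⟩ := coord_cases c
  · simp [pi0_cx, hσ.1 r]
  · simp [pi0_cy, cx_ne_cy, (hσ.1 r).le]

lemma conj_inj {μ : ℕ} {σ σ' : Equiv.Perm (Fin (2*μ))} (hσ : σ ∈ pfPerms μ)
    (hσ' : σ' ∈ pfPerms μ) (h : σ * pi0 μ * σ⁻¹ = σ' * pi0 μ * σ'⁻¹) : σ = σ' := by
  have hr : Set.range (fun i => σ (cx i)) = Set.range (fun i => σ' (cx i)) := by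
    rw [range_cx hσ, range_cx hσ', h]
  have h1 : StrictMono (fun i => σ (cx i)) := fun i j hij => (mem_pfPerms.1 hσ).2 i j hij
  have h2 : StrictMono (fun i => σ' (cx i)) := fun i j hij => (mem_pfPerms.1 hσ').2 i j hij
  have h3 := (StrictMono.range_inj h1 h2).1 hr
  have h4 : ∀ i, σ (cx i) = σ' (cx i) := fun i => congrFun h3 i
  have key : ∀ (ρ : Equiv.Perm (Fin (2*μ))) i, ρ (cy i) = (ρ * pi0 μ * ρ⁻¹) (ρ (cx i)) := by
    intro ρ i; simp [pi0_cx]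
  refine Equiv.ext fun c => ?_
  obtain ⟨r, rfl | rfl⟩ := coord_cases c
  · exact h4 r
  · rw [key, key, h, h4]

lemma conj_surj {μ : ℕ} {τ : Equiv.Perm (Fin (2*μ))} (hτ : IsFpf τ) :
    ∃ σ ∈ pfPerms μ, σ * pi0 μ * σ⁻¹ = τ := by
  obtain ⟨h1, h2⟩ := hτ
  let T : Finset (Fin (2*μ)) := {a | a < τ a}
  have hT : T.card = μ := by
    have e1 : T.card = #{a | ¬ a < τ a} := by
      refine Finset.card_bij (fun a _ => τ a) ?_ ?_ ?_
      · intro a ha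
        simp only [T, mem_filter, mem_univ, true_and] at ha ⊢
        rw [h1]; exact ha.le.not_gt
      · intro a _ b _ h; exact τ.injective h
      · intro b hb
        simp only [mem_filter, mem_univ, true_and, not_lt] at hb
        refine ⟨τ b, ?_, h1 b⟩
        simp only [T, mem_filter, mem_univ, true_and, h1]
        exact lt_of_le_of_ne hb (h2 b)
    have e2 := Finset.card_filter_add_card_filter_not (s := (univ : Finset (Fin (2*μ))))
      (fun a => a < τ a)
    rw [← e1] at e2
    simp only [Finset.card_univ, Fintype.card_fin] at e2
    change T.card + T.card = 2 * μ at e2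
    omega
  let e := T.orderEmbOfFin hT
  have he : ∀ i, e i < τ (e i) := fun i => by
    have := T.orderEmbOfFin_mem hT i
    exact (mem_filter.1 this).2
  have hee : ∀ i j, e i ≠ τ (e j) := fun i j h => by
    have a1 := he i
    rw [h, h1] at a1
    exact absurd a1 (he j).not_gt
  let s : Fin (2*μ) → Fin (2*μ) := fun c =>
    if c.1 % 2 = 0 then e ⟨c.1/2, by have := c.2; omega⟩
    else τ (e ⟨c.1/2, by have := c.2; omega⟩)
  have sx : ∀ i, s (cx i) = e i := fun i => by
    simp [s, cx]
  have sy : ∀ i, s (cy i) = τ (e i) := fun i => by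
    have a1 : (2 * i.1 + 1) % 2 = 1 := by omega
    have a2 : (2 * i.1 + 1) / 2 = i.1 := by omega
    simp [s, cy, a2]
  have sinj : Function.Injective s := by
    intro a b hab
    obtain ⟨r, rfl | rfl⟩ := coord_cases a <;> obtain ⟨q, rfl | rfl⟩ := coord_cases b
    · rw [sx, sx] at hab
      rw [e.injective hab]
    · rw [sx, sy] at hab
      exact absurd hab (hee _ _)
    · rw [sx, sy] at hab
      exact absurd hab.symm (hee _ _)
    · rw [sy, sy] at hab
      rw [e.injective (τ.injective hab)]
  let σ : Equiv.Perm (Fin (2*μ)) := Equiv.ofBijective s (Finite.injective_iff_bijective.1 sinj)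
  have σx : ∀ i, σ (cx i) = e i := sx
  have σy : ∀ i, σ (cy i) = τ (e i) := sy
  refine ⟨σ, ?_, ?_⟩
  · rw [mem_pfPerms]
    refine ⟨fun i => ?_, fun i j hij => ?_⟩
    · rw [σx, σy]; exact he i
    · rw [σx, σx]; exact e.strictMono hij
  · refine Equiv.ext fun a => ?_
    obtain ⟨c, rfl⟩ := σ.surjective a
    obtain ⟨r, rfl | rfl⟩ := coord_cases c
    · rw [Equiv.Perm.mul_apply, show σ⁻¹ (σ _) = _ from σ.symm_apply_apply _, Equiv.Perm.mul_apply, pi0_cx, σx, σy]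
    · rw [Equiv.Perm.mul_apply, show σ⁻¹ (σ _) = _ from σ.symm_apply_apply _, Equiv.Perm.mul_apply, pi0_cy, σx, σy, h1]

/-- the plane index and the type of the `i`-th test vector -/
def tr {ν : ℕ} (hν : 1 ≤ ν) {μ : ℕ} (i : Fin (2*μ)) : Fin ν :=
  if h : i.1 < 2*ν then ⟨i.1/2, by omega⟩ else ⟨0, hν⟩

def tb (ν : ℕ) {μ : ℕ} (i : Fin (2*μ)) : Bool := decide (i.1 < 2*ν ∧ i.1 % 2 = 0)

def Allowed {ν : ℕ} (hν : 1 ≤ ν) {μ : ℕ} (a b : Fin (2*μ)) : Prop :=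
  tr hν a = tr hν b ∧ ¬ (tb ν a = true ∧ tb ν b = true)

lemma Allowed.symm {ν : ℕ} {hν : 1 ≤ ν} {μ : ℕ} {a b : Fin (2*μ)} (h : Allowed hν a b) :
    Allowed hν b a := ⟨h.1.symm, fun h' => h.2 ⟨h'.2, h'.1⟩⟩

lemma tb_cy (ν : ℕ) {μ : ℕ} (i : Fin μ) : tb ν (cy i) = false := by
  simp [tb, cy]

lemma tb_cx (ν : ℕ) {μ : ℕ} (i : Fin μ) : tb ν (cx i) = decide (i.1 < ν) := by
  simp [tb, cx]

lemma tr_cx {ν : ℕ} (hν : 1 ≤ ν) {μ : ℕ} (i : Fin μ) :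
    tr hν (cx i) = if h : i.1 < ν then ⟨i.1, h⟩ else ⟨0, hν⟩ := by
  have : 2 * i.1 < 2 * ν ↔ i.1 < ν := by omega
  simp [tr, cx]

lemma tr_cy {ν : ℕ} (hν : 1 ≤ ν) {μ : ℕ} (i : Fin μ) :
    tr hν (cy i) = if h : i.1 < ν then ⟨i.1, h⟩ else ⟨0, hν⟩ := by
  have h1 : 2 * i.1 + 1 < 2 * ν ↔ i.1 < ν := by omega
  have h2 : (2 * i.1 + 1) / 2 = i.1 := by omega
  simp [tr, cy, h1, h2]

open Classical in
noncomputable def YJ {ν : ℕ} (hν : 1 ≤ ν) {μ : ℕ} (J : Finset (Fin μ)) :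
    Finset (Equiv.Perm (Fin (2*μ))) :=
  {τ | (IsFpf τ ∧ ∀ a, Allowed hν a (τ a)) ∧
    ∀ j ∈ J, ∀ a, τ (Equiv.swap (cx j) (cy j) a) = Equiv.swap (cx j) (cy j) (τ a)}

lemma mem_YJ {ν : ℕ} {hν : 1 ≤ ν} {μ : ℕ} {J : Finset (Fin μ)} {τ : Equiv.Perm (Fin (2*μ))} :
    τ ∈ YJ hν J ↔ (IsFpf τ ∧ ∀ a, Allowed hν a (τ a)) ∧
    ∀ j ∈ J, ∀ a, τ (Equiv.swap (cx j) (cy j) a) = Equiv.swap (cx j) (cy j) (τ a) := by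
  simp [YJ]

lemma swap_types {ν : ℕ} (hν : 1 ≤ ν) {μ : ℕ} (j : Fin μ) (hj : ν ≤ j.1) (a : Fin (2*μ)) :
    tr hν (Equiv.swap (cx j) (cy j) a) = tr hν a ∧ tb ν (Equiv.swap (cx j) (cy j) a) = tb ν a := by
  by_cases h1 : a = cx j
  · subst h1
    simp [tr_cx, tr_cy, tb_cx, tb_cy, hj.not_gt]
  by_cases h2 : a = cy j
  · subst h2
    simp [tr_cx, tr_cy, tb_cx, tb_cy, hj.not_gt]
  rw [Equiv.swap_apply_of_ne_of_ne h1 h2]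
  exact ⟨rfl, rfl⟩

lemma swap_comm_swap {μ : ℕ} (i j : Fin μ) (a : Fin (2*μ)) :
    Equiv.swap (cx i) (cy i) (Equiv.swap (cx j) (cy j) a) =
      Equiv.swap (cx j) (cy j) (Equiv.swap (cx i) (cy i) a) := by
  by_cases hij : i = j
  · subst hij; rfl
  have hd : Equiv.Perm.Disjoint (Equiv.swap (cx i) (cy i)) (Equiv.swap (cx j) (cy j)) := by
    intro c
    by_cases h : c = cx i ∨ c = cy i
    · right
      rcases h with rfl | rfl
      · exact Equiv.swap_apply_of_ne_of_ne (by rwa [ne_eq, cx_inj]) cx_ne_cy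
      · exact Equiv.swap_apply_of_ne_of_ne cy_ne_cx (by rwa [ne_eq, cy_inj])
    · left
      push Not at h
      exact Equiv.swap_apply_of_ne_of_ne h.1 h.2
  exact DFunLike.congr_fun hd.commute.eq a

lemma card_YJ {ν : ℕ} (hν : 1 ≤ ν) {μ : ℕ} (J : Finset (Fin μ)) (hJ : ∀ j ∈ J, ν ≤ j.1) :
    ((YJ hν (∅ : Finset (Fin μ))).card : ZMod 2) = (YJ hν J).card := by
  classical
  induction J using Finset.induction_on with
  | empty => rfl
  | insert j J hjJ ih =>
    rw [ih (fun i hi => hJ i (mem_insert_of_mem hi))]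
    have hj : ν ≤ j.1 := hJ j (mem_insert_self _ _)
    set s := Equiv.swap (cx j) (cy j) with hs
    have hss : ∀ a, s (s a) = a := fun a => Equiv.swap_apply_self _ _ _
    let Q : Equiv.Perm (Fin (2*μ)) → Prop := fun τ => ∀ a, τ (s a) = s (τ a)
    have hf : YJ hν (insert j J) = (YJ hν J).filter Q := by
      ext τ
      simp only [mem_filter, mem_YJ, mem_insert, forall_eq_or_imp, Q]
      tauto
    rw [hf, ← Finset.card_filter_add_card_filter_not (s := YJ hν J) Q]
    push_cast
    have h0 : (((YJ hν J).filter (fun τ => ¬ Q τ)).card : ZMod 2) = 0 := by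
      rw [Finset.card_eq_sum_ones]
      push_cast
      refine Finset.sum_involution (fun τ _ => s * τ * s) ?_ ?_ ?_ ?_
      · intro _ _; decide
      · intro τ hτ _ h
        refine (mem_filter.1 hτ).2 fun a => ?_
        have := DFunLike.congr_fun h (s a)
        simp only [Equiv.Perm.mul_apply, hss] at this
        exact this.symm
      · intro τ hτ
        rw [mem_filter, mem_YJ] at hτ ⊢
        obtain ⟨⟨⟨⟨t1, t2⟩, t3⟩, t4⟩, t5⟩ := hτ
        refine ⟨⟨⟨⟨fun a => ?_, fun a h => ?_⟩, fun a => ?_⟩, fun i hi a => ?_⟩, fun h => t5 fun a => ?_⟩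
        · simp [Equiv.Perm.mul_apply, hss, t1]
        · simp only [Equiv.Perm.mul_apply] at h
          refine t2 (s a) ?_
          rw [← hss (τ (s a)), h]
        · have h := t3 (s a)
          simp only [Equiv.Perm.mul_apply]
          have e1 := swap_types hν j hj a
          have e2 := swap_types hν j hj (τ (s a))
          rw [← hs] at e1 e2
          unfold Allowed at h ⊢
          rw [e1.1, e1.2] at h
          rw [e2.1, e2.2]
          exact h
        · simp only [Equiv.Perm.mul_apply]
          rw [hs, swap_comm_swap j i, ← hs, t4 i hi, hs, swap_comm_swap j i]
        · have := h a
          simp only [Equiv.Perm.mul_apply, hss] at this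
          exact this.symm
      · intro τ _
        refine Equiv.ext fun a => ?_
        simp [Equiv.Perm.mul_apply, hss]
    rw [h0, add_zero]

lemma YJ_top {ν : ℕ} (hν : 1 ≤ ν) {μ : ℕ} :
    YJ hν ({j | ν ≤ j.1} : Finset (Fin μ)) = {pi0 μ} := by
  ext τ
  rw [mem_YJ, mem_singleton]
  constructor
  · rintro ⟨⟨⟨t1, t2⟩, t3⟩, t4⟩
    simp only [mem_filter, mem_univ, true_and] at t4
    have hbig : ∀ j : Fin μ, ν ≤ j.1 → τ (cx j) = cy j := by
      intro j hj
      by_contra h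
      have := t4 j hj (cx j)
      rw [Equiv.swap_apply_left, Equiv.swap_apply_of_ne_of_ne (t2 _) h] at this
      exact cy_ne_cx (τ.injective this)
    have hall : ∀ j : Fin μ, τ (cx j) = cy j := by
      intro j
      by_cases hj : ν ≤ j.1
      · exact hbig j hj
      push Not at hj
      have h3 := t3 (cx j)
      obtain ⟨i, hi⟩ := coord_cases (τ (cx j))
      by_cases hi' : ν ≤ i.1
      · have b1 := hbig i hi'
        have b2 : τ (cy i) = cx i := by rw [← b1, t1]
        rcases hi with hi | hi
        · rw [← b2] at hi
          exact absurd (τ.injective hi) cx_ne_cy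
        · rw [← b1] at hi
          have := cx_inj.1 (τ.injective hi)
          subst this
          omega
      · push Not at hi'
        rcases hi with hi | hi
        · rw [hi] at h3
          exact absurd ⟨by simpa [tb_cx] using hj, by simpa [tb_cx] using hi'⟩ h3.2
        · rw [hi] at h3 ⊢
          have := h3.1
          rw [tr_cx, tr_cy, dif_pos hj, dif_pos hi', Fin.mk.injEq] at this
          rw [Fin.ext this]
    refine Equiv.ext fun c => ?_
    obtain ⟨i, rfl | rfl⟩ := coord_cases c
    · rw [hall, pi0_cx]
    · rw [pi0_cy, ← hall, t1]
  · rintro rfl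
    refine ⟨⟨by simpa using conj_fpf (1 : Equiv.Perm (Fin (2*μ))), fun a => ?_⟩, fun j _ a => ?_⟩
    · obtain ⟨i, rfl | rfl⟩ := coord_cases a
      · rw [pi0_cx]
        exact ⟨by rw [tr_cx, tr_cy], by simp [tb_cy]⟩
      · rw [pi0_cy]
        exact ⟨by rw [tr_cx, tr_cy], by simp [tb_cy]⟩
    · have := Equiv.mul_swap_eq_swap_mul (pi0 μ) (cx j) (cy j)
      rw [pi0_cx, pi0_cy, Equiv.swap_comm (cy j)] at this
      exact DFunLike.congr_fun this a

open Classical in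
lemma card_allowed {ν : ℕ} (hν : 1 ≤ ν) {μ : ℕ} :
    (((pfPerms μ).filter (fun σ => ∀ i, Allowed hν (σ (cx i)) (σ (cy i)))).card : ZMod 2) = 1 := by
  have h : ((pfPerms μ).filter (fun σ => ∀ i, Allowed hν (σ (cx i)) (σ (cy i)))).card =
      (YJ hν (∅ : Finset (Fin μ))).card := by
    refine Finset.card_bij (fun σ _ => σ * pi0 μ * σ⁻¹) ?_ ?_ ?_
    · intro σ hσ
      rw [mem_filter] at hσ
      rw [mem_YJ]
      refine ⟨⟨conj_fpf σ, fun a => ?_⟩, by simp⟩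
      obtain ⟨c, rfl⟩ := σ.surjective a
      obtain ⟨r, rfl | rfl⟩ := coord_cases c
      · simpa [pi0_cx] using hσ.2 r
      · simpa [pi0_cy] using (hσ.2 r).symm
    · intro σ hσ σ' hσ' h
      exact conj_inj (mem_filter.1 hσ).1 (mem_filter.1 hσ').1 h
    · intro τ hτ
      rw [mem_YJ] at hτ
      obtain ⟨σ, hσ, rfl⟩ := conj_surj hτ.1.1
      refine ⟨σ, mem_filter.2 ⟨hσ, fun i => ?_⟩, rfl⟩
      simpa [pi0_cx] using hτ.1.2 (σ (cx i))
  rw [h, card_YJ hν {j | ν ≤ j.1} (by simp), YJ_top]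
  simp

/-- bilinear form on integer vectors -/
def bform {ν : ℕ} (v w : Fin (2*ν) → ℤ) : ℤ :=
  ∑ r, (v (cx r) * w (cy r) + v (cy r) * w (cx r))

lemma ev_Bpoly {ν m : ℕ} (v : Fin m → Fin (2*ν) → ℤ) (i j : Fin m) :
    ev v (Bpoly (2*ν) m i j) = C (bform (v i) (v j)) * (X i * X j) := by
  unfold Bpoly
  rw [dif_neg (by omega), add_zero,
    sum_half (fun r : Fin ν => (X (i, cx r) * X (j, cy r) + X (i, cy r) * X (j, cx r) :
      MvPolynomial (Fin m × Fin (2*ν)) ℤ)) _ (fun r hr => rfl)]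
  simp only [map_sum, map_add, map_mul, ev_X, bform, Finset.sum_mul]
  refine Finset.sum_congr rfl fun r _ => ?_
  ring

/-- weights -/
def uu (ν : ℕ) {μ : ℕ} (i : Fin (2*μ)) : ℤ := if tb ν i then 1 else 2

open Classical in
lemma two_bform {ν : ℕ} (hν : 1 ≤ ν) {μ : ℕ} (a b : Fin (2*μ)) :
    2 * bform (bvec ℤ (tr hν a) (tb ν a)) (bvec ℤ (tr hν b) (tb ν b)) =
      if Allowed hν a b then uu ν a * uu ν b else 0 := by
  have hA : (if Allowed hν a b then uu ν a * uu ν b else 0) =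
      if tr hν a = tr hν b ∧ ¬ (tb ν a = true ∧ tb ν b = true) then uu ν a * uu ν b else 0 :=
    if_congr Iff.rfl rfl rfl
  rw [hA]
  simp only [bform, bvec_cx, bvec_cy, uu]
  generalize tr hν a = x
  generalize tr hν b = y
  by_cases h : x = y
  · subst h
    cases tb ν a <;> cases tb ν b <;> simp [Finset.sum_add_distrib]
  · simp [h, Finset.sum_add_distrib, Ne.symm h]

lemma prod_uu {ν μ : ℕ} (hμν : ν < μ) : ∏ j : Fin (2*μ), uu ν j = 2^μ * 2^(μ - ν) := by
  rw [← prod_pairs]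
  have : ∀ i : Fin μ, uu ν (cx i) * uu ν (cy i) = 2 * (if i.1 < ν then 1 else 2) := by
    intro i
    simp only [uu, tb_cx, tb_cy]
    by_cases h : i.1 < ν <;> simp [h]
  simp only [this, Finset.prod_mul_distrib, Finset.prod_ite]
  have hc : #{i : Fin μ | ¬ i.1 < ν} = μ - ν := by
    have h1 := Finset.card_filter_add_card_filter_not (s := (univ : Finset (Fin μ)))
      (fun i => i.1 < ν)
    have h2 : #{i : Fin μ | i.1 < ν} = ν := by
      rw [Fin.card_filter_val_lt]; omega
    simp only [Finset.card_univ, Fintype.card_fin] at h1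
    omega
  rw [Finset.prod_const, Finset.prod_const, Finset.prod_const, hc]
  simp

open Classical in
lemma prod_beta {ν : ℕ} (hν : 1 ≤ ν) {μ : ℕ} (hμν : ν < μ) (σ : Equiv.Perm (Fin (2*μ))) :
    ∏ i : Fin μ, bform (bvec ℤ (tr hν (σ (cx i))) (tb ν (σ (cx i))))
      (bvec ℤ (tr hν (σ (cy i))) (tb ν (σ (cy i)))) =
      if ∀ i, Allowed hν (σ (cx i)) (σ (cy i)) then 2^(μ - ν) else 0 := by
  have h2 : (2 : ℤ)^μ ≠ 0 := by positivity
  apply mul_left_cancel₀ h2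
  have : (2 : ℤ)^μ = ∏ i : Fin μ, 2 := by simp
  conv_lhs => rw [this]
  rw [← Finset.prod_mul_distrib]
  simp only [two_bform]
  split_ifs with h
  · rw [← prod_uu hμν, ← Equiv.prod_comp σ, ← prod_pairs (fun j => uu ν (σ j))]
    exact Finset.prod_congr rfl fun i _ => if_pos (h i)
  · push Not at h
    obtain ⟨i, hi⟩ := h
    rw [mul_zero]
    exact Finset.prod_eq_zero (mem_univ i) (if_neg hi)

lemma coeff_ev_pf {ν μ : ℕ} (v : Fin (2*μ) → Fin (2*ν) → ℤ) :
    coeff (Finsupp.equivFunOnFinite.symm fun _ => 1) (ev v (pfaffian (Bmat (2*ν) μ))) =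
      ∑ σ ∈ pfPerms μ, (Equiv.Perm.sign σ : ℤ) *
        ∏ i : Fin μ, bform (v (σ (cx i))) (v (σ (cy i))) := by
  unfold pfaffian
  rw [map_sum, coeff_sum]
  refine Finset.sum_congr rfl fun σ hσ => ?_
  rw [mem_pfPerms] at hσ
  rw [map_zsmul, coeff_smul, smul_eq_mul]
  congr 1
  rw [map_prod]
  have h1 : ∀ i : Fin μ, ev v (Bmat (2*ν) μ (σ (cx i)) (σ (cy i))) =
      C (bform (v (σ (cx i))) (v (σ (cy i)))) * (X (σ (cx i)) * X (σ (cy i))) := by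
    intro i
    unfold Bmat
    rw [if_pos (hσ.1 i), ev_Bpoly]
  change coeff _ (∏ i : Fin μ, ev v (Bmat (2*ν) μ (σ (cx i)) (σ (cy i)))) = _
  simp only [h1]
  rw [Finset.prod_mul_distrib, ← map_prod, coeff_C_mul, prod_pairs (fun j => X (σ j)),
    Equiv.prod_comp σ (fun j => (X j : MvPolynomial (Fin (2*μ)) ℤ))]
  have : (∏ j : Fin (2*μ), (X j : MvPolynomial (Fin (2*μ)) ℤ)) =
      monomial (Finsupp.equivFunOnFinite.symm fun _ => 1) 1 := by
    rw [monomial_eq, Finsupp.prod_fintype _ _ (by simp)]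
    simp
  rw [this, coeff_monomial, if_pos rfl, mul_one]

lemma coeff_gt_odd {ν μ : ℕ} (hν : 1 ≤ ν) (hμν : ν < μ)
    (gt : MvPolynomial (Fin (2*μ) × Fin (2*ν)) ℤ)
    (hg : (2 ^ (μ - ν) : MvPolynomial (Fin (2*μ) × Fin (2*ν)) ℤ) * gt =
      pfaffian (Bmat (2*ν) μ)) :
    Odd (coeff (Finsupp.equivFunOnFinite.symm fun _ => 1)
      (ev (fun i => bvec ℤ (tr hν i) (tb ν i)) gt)) := by
  classical
  have h := coeff_ev_pf (μ := μ) (fun i => bvec ℤ (tr hν i) (tb ν i))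
  rw [← hg] at h
  have e : (2 ^ (μ - ν) : MvPolynomial (Fin (2*μ) × Fin (2*ν)) ℤ) = C (2^(μ-ν)) := by simp
  rw [e, map_mul, ← algebraMap_eq, AlgHom.commutes, algebraMap_eq, coeff_C_mul] at h
  simp only [prod_beta hν hμν, mul_ite, mul_zero] at h
  rw [← Finset.sum_filter, ← Finset.sum_mul, mul_comm] at h
  have h2 : (2 : ℤ)^(μ - ν) ≠ 0 := by positivity
  rw [mul_right_cancel₀ h2 h]
  rw [← ZMod.intCast_eq_one_iff_odd]
  push_cast
  rw [← card_allowed (μ := μ) hν, Finset.card_eq_sum_ones]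
  push_cast
  refine Finset.sum_congr rfl fun σ _ => ?_
  rcases Int.units_eq_one_or (Equiv.Perm.sign σ) with h | h <;> rw [h] <;> decide

end pfaff

lemma map_ev {k : Type*} [CommRing k] {m n : ℕ} (v : Fin m → Fin n → ℤ)
    (p : MvPolynomial (Fin m × Fin n) ℤ) :
    ev (fun i c => ((v i c : ℤ) : k)) (MvPolynomial.map (Int.castRingHom k) p) =
      MvPolynomial.map (Int.castRingHom k) (ev v p) := by
  induction p using MvPolynomial.induction_on with
  | C a =>
    rw [map_C, ← algebraMap_eq, ← algebraMap_eq, AlgHom.commutes, AlgHom.commutes,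
      algebraMap_eq, algebraMap_eq, map_C]
  | add p q hp hq => simp only [map_add, hp, hq]
  | mul_X p ic hp =>
    obtain ⟨i, c⟩ := ic
    rw [map_mul, map_mul, map_mul, map_mul, hp, map_X, ev_X, ev_X, map_mul, map_C, map_X]
    rfl

lemma main {k : Type*} [Field k] [CharP k 2] [Infinite k]
    (ν μ : ℕ) (hν : 1 ≤ ν) (hμν : ν < μ)
    (gt : MvPolynomial (Fin (2*μ) × Fin (2*ν)) ℤ)
    (hg : (2 ^ (μ - ν) : MvPolynomial (Fin (2*μ) × Fin (2*ν)) ℤ) * gt =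
      pfaffian (Bmat (2*ν) μ)) :
    MvPolynomial.map (Int.castRingHom k) gt ∉
      Algebra.adjoin k {p : MvPolynomial (Fin (2*μ) × Fin (2*ν)) k |
        (∀ g : Matrix (Fin (2*ν)) (Fin (2*ν)) k, inO g → substAct g p = p) ∧
        p.totalDegree < 2*μ} := by
  intro hmem
  have hodd := coeff_gt_odd hν hμν gt hg
  have hb := adjoin_bound hν hμν _ hmem (tr hν) (tb ν)
    (Finsupp.equivFunOnFinite.symm fun _ => 1) (by simp) (by
      have e : (fun i : Fin (2*μ) => bvec k (tr hν i) (tb ν i)) =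
          fun i c => ((bvec ℤ (tr hν i) (tb ν i) c : ℤ) : k) := by
        funext i c
        simp only [bvec]
        split_ifs <;> simp
      rw [e, map_ev (fun i => bvec ℤ (tr hν i) (tb ν i)), coeff_map]
      obtain ⟨q, hq⟩ := hodd
      rw [hq]
      have h2 : (2 : k) = 0 := CharTwo.two_eq_zero
      simp [h2])
  have h1 := hb.2 (by simp)
  have h3 : ∑ i : Fin (2*μ), (if tb ν i then 1 else 0) ≤ ν := by
    rw [← sum_pairs]
    simp only [tb_cx, tb_cy, decide_eq_true_eq, Bool.false_eq_true, if_false, add_zero]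
    rw [← Finset.card_filter, Fin.card_filter_val_lt]
    omega
  simp only [Finsupp.equivFunOnFinite_symm_apply_apply, one_mul] at h1
  omega

end GInd

/-- For `m = 2μ > n = 2ν ≥ 2` both even, the mod-2 reduction `g` of `Pf(B⁽ⁱʲ⁾)/2^(μ−ν)` is an
indecomposable `O(n)`-invariant over an algebraically closed field `k` of characteristic 2:
it does not lie in the subalgebra generated by the invariants of degree strictly less
than `m`. -/
theorem g_indecomposable_O_even
    (k : Type*) [Field k] [IsAlgClosed k] [CharP k 2]
    (ν μ : ℕ) (hν : 1 ≤ ν) (hμν : ν < μ)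
    (gt : MvPolynomial (Fin (2*μ) × Fin (2*ν)) ℤ)
    (hg : (2 ^ (μ - ν) : MvPolynomial (Fin (2*μ) × Fin (2*ν)) ℤ) * gt =
      pfaffian (Bmat (2*ν) μ)) :
    MvPolynomial.map (Int.castRingHom k) gt ∉
      Algebra.adjoin k {p : MvPolynomial (Fin (2*μ) × Fin (2*ν)) k |
        (∀ g : Matrix (Fin (2*ν)) (Fin (2*ν)) k, inO g → substAct g p = p) ∧
        p.totalDegree < 2*μ} := by
  exact GInd.main ν μ hν hμν gt hg
end
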